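/- Let s ≥ 2 be an integer, r_1,...,r_s real numbers each greater than 1 and none of them an integer, and λ ≥ 1 a real number such that 1/r_1 + ... + 1/r_{s−1} + 1/(λ r_s) = 1. Let r(n) denote the number of representations n = p + a with p prime and a ∈ A. Then Σ_{n ≤ x} r(n)^2 ≪ x; that is, there exist C > 0 and x_0 such that for all x ≥ x_0, the number of quadruples (p_1, a_1, p_2, a_2) with p_1, p_2 prime, a_1, a_2 ∈ A and p_1 + a_1 = p_2 + a_2 ≤ x is at most C·x. -/

import Mathlib

/-- The set `A = { 2^⌊k_1^{r_1}⌋ + ... + 2^⌊k_{s-1}^{r_{s-1}}⌋ + 2^⌊⌊k_s^λ⌋^{r_s}⌋ }`,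
with `k_1, ..., k_s` ranging over positive integers (indices 0-based: the last index is
`s - 1`). -/
def romA (s : ℕ) (hs : 0 < s) (r : Fin s → ℝ) (lam : ℝ) : Set ℕ :=
  {n | ∃ k : Fin s → ℕ, (∀ i, 0 < k i) ∧
    n = (∑ i ∈ Finset.univ.filter (fun i : Fin s => (i : ℕ) < s - 1),
          2 ^ ⌊(k i : ℝ) ^ (r i)⌋₊)
      + 2 ^ ⌊((⌊(k ⟨s - 1, by omega⟩ : ℝ) ^ lam⌋₊ : ℕ) : ℝ) ^ (r ⟨s - 1, by omega⟩)⌋₊}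

/-- The iterated forward difference of `x ↦ x ^ ρ` with the listed steps. -/
noncomputable def rpowDiff : List ℕ → ℝ → ℝ → ℝ
  | [], ρ, x => x ^ ρ
  | h :: hs, ρ, x => rpowDiff hs ρ (x + h) - rpowDiff hs ρ x

lemma hasDerivAt_rpowDiff (hs : List ℕ) (ρ : ℝ) {x : ℝ} (hx : 0 < x) :
    HasDerivAt (rpowDiff hs ρ) (ρ * rpowDiff hs (ρ - 1) x) x := by
  induction hs generalizing x with
  | nil => exact Real.hasDerivAt_rpow_const (Or.inl hx.ne')
  | cons h hs ih =>
    have h1 : HasDerivAt (fun y : ℝ => rpowDiff hs ρ (y + h))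
        (ρ * rpowDiff hs (ρ - 1) (x + h)) x :=
      (ih (x := x + h) (by positivity)).comp_add_const x (h : ℝ)
    have h2 := h1.sub (ih hx)
    rw [← mul_sub] at h2
    exact h2

lemma exists_rpowDiff_eq (hs : List ℕ) (hpos : ∀ h ∈ hs, 0 < h) (ρ : ℝ) {x : ℝ} (hx : 0 < x) :
    ∃ ξ, x ≤ ξ ∧ ξ ≤ x + (hs.sum : ℕ) ∧ rpowDiff hs ρ x =
      (hs.prod : ℕ) * (∏ i ∈ Finset.range hs.length, (ρ - i)) * ξ ^ (ρ - hs.length) := by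
  induction hs generalizing ρ x with
  | nil => exact ⟨x, le_rfl, by simp, by simp [rpowDiff]⟩
  | cons h hs ih =>
    have hh : 0 < h := hpos h (by simp)
    have hlt : x < x + h := by simpa using hh
    obtain ⟨c, hc, hceq⟩ := exists_hasDerivAt_eq_slope (rpowDiff hs ρ)
      (fun y => ρ * rpowDiff hs (ρ - 1) y) hlt
      (fun y hy => (hasDerivAt_rpowDiff hs ρ (hx.trans_le hy.1)).continuousAt.continuousWithinAt)
      (fun y hy => hasDerivAt_rpowDiff hs ρ (hx.trans hy.1))
    obtain ⟨ξ, h1, h2, h3⟩ := ih (fun a ha => hpos a (by simp [ha])) (ρ - 1) (hx.trans hc.1)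
    refine ⟨ξ, hc.1.le.trans h1, h2.trans ?_, ?_⟩
    · have := hc.2
      push_cast [List.sum_cons]
      linarith
    · have hh' : (h : ℝ) ≠ 0 := by positivity
      rw [h3, eq_div_iff (by simpa using hh')] at hceq
      simp only [rpowDiff]
      rw [← hceq, List.length_cons, Finset.prod_range_succ']
      have e1 : ρ - 1 - (hs.length : ℝ) = ρ - ((hs.length + 1 : ℕ) : ℝ) := by push_cast; ring
      have e2 : ∀ i ∈ Finset.range hs.length, ρ - 1 - (i : ℝ) = ρ - ((i + 1 : ℕ) : ℝ) := by
        intro i _; push_cast; ring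
      rw [e1, Finset.prod_congr rfl e2, List.prod_cons]
      push_cast
      ring

/-- A subset of `[1, K]` with at least two elements has many pairs with a common small
difference. -/
lemma exists_popular_difference {K : ℕ} {S : Finset ℕ} (hS : S ⊆ Finset.Icc 1 K)
    (h2 : 2 ≤ S.card) :
    ∃ h : ℕ, 0 < h ∧ S.card * h ≤ 4 * K ∧
      S.card ^ 2 ≤ 24 * K * (S.filter (fun k => k + h ∈ S)).card := by
  have hnK : S.card ≤ K := by simpa using Finset.card_le_card hS
  set n := S.card with hn
  set G := 4 * K / n with hG
  have hGn : n * G ≤ 4 * K := Nat.mul_div_le _ _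
  have hGn' : 4 * K < n * G + n := by
    have := Nat.lt_div_mul_add (a := 4 * K) (b := n) (by omega)
    rw [mul_comm n G]; exact this
  have hG0 : 0 < G := Nat.div_pos (by omega) (by omega)
  set S1 := S.filter (fun k => ∃ h ∈ Finset.Icc 1 G, k + h ∈ S) with hS1
  have hcompl : (S.filter (fun k => ¬ ∃ h ∈ Finset.Icc 1 G, k + h ∈ S)).card ≤ K / G + 1 := by
    rw [← Finset.card_range (K / G + 1)]
    apply Finset.card_le_card_of_injOn (fun k => k / G)
    · intro k hk
      simp only [Finset.coe_filter, Set.mem_ofPred_eq] at hk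
      have := Finset.mem_Icc.1 (hS hk.1)
      simp only [Finset.coe_range, Set.mem_Iio]
      exact Nat.lt_succ_of_le (Nat.div_le_div_right this.2)
    · have key : ∀ a b : ℕ, (¬ ∃ h ∈ Finset.Icc 1 G, a + h ∈ S) → b ∈ S → a < b →
          a / G = b / G → False := by
        intro a b ha hb hab he
        apply ha
        refine ⟨b - a, ?_, ?_⟩
        · rw [Finset.mem_Icc]
          have h1 := Nat.div_add_mod a G
          have h3 := Nat.div_add_mod b G
          have h4 := Nat.mod_lt b hG0
          rw [he] at h1
          omega
        · rwa [Nat.add_sub_cancel' hab.le]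
      intro a ha b hb he
      simp only [Finset.coe_filter, Set.mem_ofPred_eq] at ha hb
      rcases lt_trichotomy a b with h | h | h
      · exact (key a b ha.2 hb.1 h he).elim
      · exact h
      · exact (key b a hb.2 ha.1 h he.symm).elim
  have hsplit : S1.card + (S.filter (fun k => ¬ ∃ h ∈ Finset.Icc 1 G, k + h ∈ S)).card = n :=
    Finset.card_filter_add_card_filter_not _
  have hS1card : n ≤ 6 * S1.card := by
    have h3 : 3 * (K / G) ≤ n := by
      by_contra hcon
      push Not at hcon
      have h5 : G * (K / G) ≤ K := Nat.mul_div_le _ _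
      have h6 : n + 1 ≤ 3 * (K / G) := hcon
      have h7 : G * (n + 1) ≤ 3 * K := by nlinarith
      nlinarith
    omega
  obtain ⟨h, hh, hmax⟩ := Finset.exists_max_image (Finset.Icc 1 G)
    (fun h => (S.filter (fun k => k + h ∈ S)).card) ⟨1, by simp; omega⟩
  rw [Finset.mem_Icc] at hh
  refine ⟨h, hh.1, le_trans (Nat.mul_le_mul_left _ hh.2) hGn, ?_⟩
  have hle : S1.card ≤ G * (S.filter (fun k => k + h ∈ S)).card := by
    have : S1 ⊆ (Finset.Icc 1 G).biUnion (fun h => S.filter (fun k => k + h ∈ S)) := by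
      intro k hk
      simp only [hS1, Finset.mem_filter] at hk
      obtain ⟨hk1, h', hh', hk2⟩ := hk
      exact Finset.mem_biUnion.2 ⟨h', hh', Finset.mem_filter.2 ⟨hk1, hk2⟩⟩
    refine (Finset.card_le_card this).trans ?_
    have := Finset.card_biUnion_le_card_mul (Finset.Icc 1 G)
      (fun h => S.filter (fun k => k + h ∈ S)) _ (fun a ha => hmax a ha)
    simpa using this
  calc n ^ 2 = n * n := sq n
    _ ≤ n * (6 * (G * (S.filter (fun k => k + h ∈ S)).card)) := by gcongr; omega
    _ = 6 * (n * G) * (S.filter (fun k => k + h ∈ S)).card := by ring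
    _ ≤ 6 * (4 * K) * (S.filter (fun k => k + h ∈ S)).card := by gcongr
    _ = _ := by ring

/-- A bound for the number of `k` at which an iterated difference of `k ^ r` with `n` steps is
close to a fixed residue class modulo `e`. -/
def RpowDiffBound (r : ℝ) (n : ℕ) : Prop :=
  ∃ C > (0 : ℝ), ∃ δ : ℝ, 0 < δ ∧ δ ≤ 1 ∧ ∀ (K e : ℕ) (M : ℝ), 1 ≤ M → M ≤ K → M ≤ e →
    ∀ hs : List ℕ, hs.length = n → (∀ h ∈ hs, 0 < h) → ∀ S : Finset ℕ,
      (∀ k ∈ S, 1 ≤ k ∧ k + hs.sum ≤ K) → ∀ c : ℝ,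
      (∀ k ∈ S, ∃ j : ℤ, |rpowDiff hs r k - c - e * j| ≤ 2 ^ n) →
      (S.card : ℝ) ≤ C * (hs.prod : ℕ) * K * M ^ (-δ)

lemma card_le_of_pairwise_sub_le (S : Finset ℕ) {W : ℝ} (hW : 0 ≤ W)
    (h : ∀ a ∈ S, ∀ b ∈ S, a < b → ((b - a : ℕ) : ℝ) ≤ W) : (S.card : ℝ) ≤ W + 1 := by
  rcases S.eq_empty_or_nonempty with rfl | hne
  · simp; linarith
  · have hsub : S ⊆ Finset.Icc (S.min' hne) (S.min' hne + ⌊W⌋₊) := by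
      intro b hb
      have h1 := S.min'_le b hb
      refine Finset.mem_Icc.2 ⟨h1, ?_⟩
      rcases h1.eq_or_lt with h2 | h2
      · omega
      · have := Nat.le_floor (h _ (S.min'_mem hne) b hb h2)
        omega
    have h3 := Finset.card_le_card hsub
    rw [Nat.card_Icc] at h3
    have h4 := Nat.floor_le hW
    have h5 : (S.card : ℝ) ≤ (⌊W⌋₊ + 1 : ℕ) := by exact_mod_cast (by omega)
    push_cast at h5
    linarith

lemma card_le_of_int_image {S : Finset ℕ} (f : ℕ → ℤ) {a b W : ℝ} (hab : a ≤ b) (hW : 0 ≤ W)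
    (hf : ∀ k ∈ S, a ≤ f k ∧ (f k : ℝ) ≤ b)
    (h : ∀ k ∈ S, ∀ l ∈ S, f k = f l → k < l → ((l - k : ℕ) : ℝ) ≤ W) :
    (S.card : ℝ) ≤ (W + 1) * (b - a + 1) := by
  have himg : ((S.image f).card : ℝ) ≤ b - a + 1 := by
    have hsub : S.image f ⊆ Finset.Icc ⌈a⌉ ⌊b⌋ := by
      intro j hj
      obtain ⟨k, hk, rfl⟩ := Finset.mem_image.1 hj
      exact Finset.mem_Icc.2 ⟨Int.ceil_le.2 (hf k hk).1, Int.le_floor.2 (hf k hk).2⟩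
    have h1 := Finset.card_le_card hsub
    rw [Int.card_Icc] at h1
    have h2 : ((S.image f).card : ℝ) ≤ ((⌊b⌋ + 1 - ⌈a⌉).toNat : ℝ) := by exact_mod_cast h1
    refine h2.trans ?_
    rcases le_total 0 (⌊b⌋ + 1 - ⌈a⌉) with h3 | h3
    · have h4 : (((⌊b⌋ + 1 - ⌈a⌉).toNat : ℤ) : ℝ) = ((⌊b⌋ + 1 - ⌈a⌉ : ℤ) : ℝ) := by
        rw [Int.toNat_of_nonneg h3]
      rw [Int.cast_natCast] at h4
      rw [h4]
      push_cast
      linarith [Int.floor_le b, Int.le_ceil a]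
    · rw [Int.toNat_of_nonpos h3]
      simp; linarith
  have hfib : ∀ j ∈ S.image f, (S.filter (fun k => f k = j)).card ≤ ⌊W + 1⌋₊ := by
    intro j _
    apply Nat.le_floor
    apply card_le_of_pairwise_sub_le _ hW
    intro k hk l hl hkl
    rw [Finset.mem_filter] at hk hl
    exact h k hk.1 l hl.1 (hk.2.trans hl.2.symm) hkl
  have := Finset.card_le_mul_card_image S _ hfib
  calc (S.card : ℝ) ≤ (⌊W + 1⌋₊ : ℝ) * ((S.image f).card : ℝ) := by exact_mod_cast this
    _ ≤ (W + 1) * (b - a + 1) := by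
      gcongr
      exact Nat.floor_le (by linarith)

lemma rpowDiffBound_floor {r : ℝ} {m : ℕ} (h0 : (m : ℝ) < r) (h1 : r < m + 1) :
    RpowDiffBound r m := by
  set θ : ℝ := r - m with hθ
  have hθ0 : 0 < θ := by linarith
  have hθ1 : θ < 1 := by linarith
  set c1 : ℝ := ∏ i ∈ Finset.range m, (r - i) with hc1
  set c2 : ℝ := ∏ i ∈ Finset.range (m + 1), (r - i) with hc2
  have hc1pos : 0 < c1 := Finset.prod_pos fun i hi => by
    have : (i : ℝ) < m := by exact_mod_cast Finset.mem_range.1 hi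
    linarith
  have hc2pos : 0 < c2 := Finset.prod_pos fun i hi => by
    have : (i : ℝ) ≤ m := by exact_mod_cast Nat.lt_succ_iff.1 (Finset.mem_range.1 hi)
    linarith
  set B : ℝ := 2 ^ m with hB
  have hBpos : 0 < B := by positivity
  refine ⟨2 * B * c1 / c2 + c1 + 2 * B / c2 * (2 * B + 1) + (2 * B + 1), by positivity,
    min θ (1 - θ), lt_min hθ0 (by linarith), (min_le_left _ _).trans hθ1.le, ?_⟩
  intro K e M hM hMK hMe hs hlen hpos S hSK c hS
  set δ := min θ (1 - θ) with hδ
  have hM0 : 0 < M := by linarith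
  have hK1 : (1 : ℝ) ≤ K := hM.trans hMK
  have hK0 : (0 : ℝ) < K := by linarith
  have he0 : (0 : ℝ) < e := by linarith
  set P : ℝ := ((hs.prod : ℕ) : ℝ) with hP
  have hP1 : 1 ≤ P := by
    have : 0 < hs.prod := List.prod_pos hpos
    rw [hP]
    exact_mod_cast this
  choose! j hj using hS
  have hval : ∀ k ∈ S, 0 ≤ rpowDiff hs r k ∧ rpowDiff hs r k ≤ P * c1 * (K : ℝ) ^ θ := by
    intro k hk
    have hkS := hSK k hk
    have hk0 : (0 : ℝ) < k := by exact_mod_cast hkS.1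
    obtain ⟨ξ, hξ1, hξ2, hξ⟩ := exists_rpowDiff_eq hs hpos r hk0
    have hξ0 : 0 < ξ := hk0.trans_le hξ1
    rw [hlen] at hξ
    rw [hξ]
    refine ⟨by positivity, ?_⟩
    have : ξ ≤ K := hξ2.trans (by exact_mod_cast hkS.2)
    gcongr
  have hgap : ∀ k ∈ S, ∀ l ∈ S, k < l →
      ((l - k : ℕ) : ℝ) * (P * c2 * (K : ℝ) ^ (θ - 1)) ≤ rpowDiff hs r l - rpowDiff hs r k := by
    intro k hk l hl hkl
    have hkS := hSK k hk
    have hlS := hSK l hl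
    have hk0 : (0 : ℝ) < k := by exact_mod_cast hkS.1
    obtain ⟨ξ, hξ1, hξ2, hξ⟩ := exists_rpowDiff_eq ((l - k) :: hs)
      (by
        intro a ha
        rcases List.mem_cons.1 ha with rfl | ha
        · omega
        · exact hpos a ha) r hk0
    have hξ0 : 0 < ξ := hk0.trans_le hξ1
    have hξK : ξ ≤ K := by
      refine hξ2.trans ?_
      rw [List.sum_cons]
      exact_mod_cast (by omega)
    have hlk : (k : ℝ) + ((l - k : ℕ) : ℝ) = l := by
      rw [← Nat.cast_add, Nat.add_sub_cancel' hkl.le]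
    rw [List.length_cons, hlen, List.prod_cons, rpowDiff, hlk] at hξ
    rw [hξ, Nat.cast_mul]
    have e1 : r - ((m + 1 : ℕ) : ℝ) = θ - 1 := by push_cast; ring
    rw [e1]
    have : (K : ℝ) ^ (θ - 1) ≤ ξ ^ (θ - 1) :=
      Real.rpow_le_rpow_of_nonpos hξ0 hξK (by linarith)
    simp only [mul_assoc]
    gcongr
  set W : ℝ := 2 * B / (P * c2 * (K : ℝ) ^ (θ - 1)) with hW
  have hden : 0 < P * c2 * (K : ℝ) ^ (θ - 1) := by positivity
  have hcard := card_le_of_int_image (S := S) j (a := (-B - c) / e)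
    (b := (P * c1 * (K : ℝ) ^ θ + B - c) / e) (W := W)
    (by
      gcongr ?_ / _
      have : 0 ≤ P * c1 * (K : ℝ) ^ θ := by positivity
      linarith) (by positivity)
    (by
      intro k hk
      have h2 := abs_le.1 (hj k hk)
      have h3 := hval k hk
      rw [div_le_iff₀ he0, le_div_iff₀ he0]
      constructor <;> nlinarith)
    (by
      intro k hk l hl hkl hlt
      have h2 := abs_le.1 (hj k hk)
      have h3 := abs_le.1 (hj l hl)
      rw [hkl] at h2
      rw [hW, le_div_iff₀ hden]
      have := hgap k hk l hl hlt
      linarith)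
  set u := M ^ (-δ) with hu
  have hu0 : 0 < u := by positivity
  have hKθ : (K : ℝ) ^ θ ≤ K * u := by
    have e1 : (K : ℝ) ^ θ = K * (K : ℝ) ^ (-(1 - θ)) := by
      nth_rw 2 [← Real.rpow_one (K : ℝ)]
      rw [← Real.rpow_add hK0]; ring_nf
    rw [e1]
    gcongr
    calc (K : ℝ) ^ (-(1 - θ)) ≤ (K : ℝ) ^ (-δ) :=
          Real.rpow_le_rpow_of_exponent_le hK1 (neg_le_neg (min_le_right _ _))
      _ ≤ M ^ (-δ) := Real.rpow_le_rpow_of_nonpos hM0 hMK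
          (by have : 0 < δ := lt_min hθ0 (by linarith)
              linarith)
  have hKθ' : (K : ℝ) ^ (1 - θ) ≤ K * u := by
    have e1 : (K : ℝ) ^ (1 - θ) = K * (K : ℝ) ^ (-θ) := by
      nth_rw 2 [← Real.rpow_one (K : ℝ)]
      rw [← Real.rpow_add hK0]; ring_nf
    rw [e1]
    gcongr
    calc (K : ℝ) ^ (-θ) ≤ (K : ℝ) ^ (-δ) :=
          Real.rpow_le_rpow_of_exponent_le hK1 (neg_le_neg (min_le_left _ _))
      _ ≤ M ^ (-δ) := Real.rpow_le_rpow_of_nonpos hM0 hMK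
          (by have : 0 < δ := lt_min hθ0 (by linarith)
              linarith)
  have hMu : M⁻¹ ≤ u := by
    rw [← Real.rpow_neg_one]
    exact Real.rpow_le_rpow_of_exponent_le hM (neg_le_neg ((min_le_left _ _).trans hθ1.le))
  have hKu : 1 ≤ K * u := (Real.one_le_rpow hK1 hθ0.le).trans hKθ
  have hWeq : W = 2 * B / c2 * (K : ℝ) ^ (1 - θ) / P := by
    rw [hW, show (1 - θ : ℝ) = -(θ - 1) by ring, Real.rpow_neg hK0.le]
    have := (Real.rpow_pos_of_pos hK0 (θ - 1)).ne'
    have := (lt_of_lt_of_le one_pos hP1).ne'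
    field_simp
  have hba : (P * c1 * (K : ℝ) ^ θ + B - c) / e - (-B - c) / e + 1 ≤
      P * c1 * (K : ℝ) ^ θ * M⁻¹ + (2 * B + 1) := by
    have h3 : (P * c1 * (K : ℝ) ^ θ + B - c) / e - (-B - c) / e =
        P * c1 * (K : ℝ) ^ θ * (e : ℝ)⁻¹ + 2 * B * (e : ℝ)⁻¹ := by field_simp; ring
    have h4 : (e : ℝ)⁻¹ ≤ M⁻¹ := by gcongr
    have h5 : (e : ℝ)⁻¹ ≤ 1 := inv_le_one_of_one_le₀ (hM.trans hMe)
    rw [h3]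
    have h6 : P * c1 * (K : ℝ) ^ θ * (e : ℝ)⁻¹ ≤ P * c1 * (K : ℝ) ^ θ * M⁻¹ := by gcongr
    have h7 : 2 * B * (e : ℝ)⁻¹ ≤ 2 * B * 1 := by gcongr
    linarith
  have hM1 : M⁻¹ ≤ 1 := inv_le_one_of_one_le₀ hM
  have hKK : (K : ℝ) ^ (1 - θ) * (K : ℝ) ^ θ = K := by
    rw [← Real.rpow_add hK0]; simp
  have hPinv : P⁻¹ ≤ 1 := inv_le_one_of_one_le₀ hP1
  have hP0 : 0 < P := by linarith
  have hPKu : K * u ≤ P * (K * u) := le_mul_of_one_le_left (by positivity) hP1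
  calc (S.card : ℝ) ≤ (W + 1) * (P * c1 * (K : ℝ) ^ θ * M⁻¹ + (2 * B + 1)) :=
        hcard.trans (by gcongr)
    _ = 2 * B * c1 / c2 * ((K : ℝ) ^ (1 - θ) * (K : ℝ) ^ θ) * M⁻¹ + P * c1 * (K : ℝ) ^ θ * M⁻¹
        + 2 * B / c2 * (2 * B + 1) * (K : ℝ) ^ (1 - θ) * P⁻¹ + (2 * B + 1) := by
      rw [hWeq]; field_simp; ring
    _ ≤ 2 * B * c1 / c2 * K * u + P * c1 * (K * u) * 1
        + 2 * B / c2 * (2 * B + 1) * (K * u) * 1 + (2 * B + 1) * (K * u) := by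
      rw [hKK]
      have : 2 * B + 1 ≤ (2 * B + 1) * (K * u) := le_mul_of_one_le_right (by positivity) hKu
      gcongr
    _ = (2 * B * c1 / c2 + 2 * B / c2 * (2 * B + 1) + (2 * B + 1)) * (K * u)
        + c1 * (P * (K * u)) := by ring
    _ ≤ (2 * B * c1 / c2 + 2 * B / c2 * (2 * B + 1) + (2 * B + 1)) * (P * (K * u))
        + c1 * (P * (K * u)) := by gcongr
    _ = _ := by ring

lemma RpowDiffBound.of_succ {r : ℝ} {n : ℕ} (h : RpowDiffBound r (n + 1)) :
    RpowDiffBound r n := by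
  obtain ⟨C, hC, δ, hδ0, hδ1, H⟩ := h
  refine ⟨96 * C + 1, by positivity, δ / 3, by positivity, by linarith, ?_⟩
  intro K e M hM hMK hMe hs hlen hpos S hSK c hS
  have hM0 : 0 < M := by linarith
  have hK1 : (1 : ℝ) ≤ K := hM.trans hMK
  have hK0 : (0 : ℝ) < K := by linarith
  set P : ℝ := ((hs.prod : ℕ) : ℝ) with hP
  have hP1 : 1 ≤ P := by
    have : 0 < hs.prod := List.prod_pos hpos
    rw [hP]
    exact_mod_cast this
  have hP0 : 0 < P := by linarith
  set v := M ^ (-(δ / 3)) with hv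
  have hv0 : 0 < v := by positivity
  rcases lt_or_ge S.card 2 with hcard | hcard
  · have h1 : (S.card : ℝ) ≤ 1 := by exact_mod_cast (by omega)
    have h2 : 1 ≤ K * v := by
      calc (1 : ℝ) ≤ M ^ (1 - δ / 3) := Real.one_le_rpow hM (by linarith)
        _ = M * v := by rw [hv, sub_eq_add_neg, Real.rpow_add hM0, Real.rpow_one]
        _ ≤ K * v := by gcongr
    have h3 : 1 ≤ (96 * C + 1) * P := one_le_mul_of_one_le_of_one_le (by linarith) hP1
    calc (S.card : ℝ) ≤ 1 := h1
      _ ≤ ((96 * C + 1) * P) * (K * v) := one_le_mul_of_one_le_of_one_le h3 h2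
      _ = _ := by ring
  · obtain ⟨d, hd0, hd1, hd2⟩ := exists_popular_difference (K := K) (S := S)
      (fun k hk => Finset.mem_Icc.2 ⟨(hSK k hk).1, by have := (hSK k hk).2; omega⟩) hcard
    set S' := S.filter (fun k => k + d ∈ S) with hS'
    have key := H K e M hM hMK hMe (d :: hs) (by simp [hlen])
      (by
        intro a ha
        rcases List.mem_cons.1 ha with rfl | ha
        · exact hd0
        · exact hpos a ha) S'
      (by
        intro k hk
        rw [hS', Finset.mem_filter] at hk
        have h1 := (hSK k hk.1).1
        have h2 := (hSK _ hk.2).2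
        rw [List.sum_cons]
        omega) 0
      (by
        intro k hk
        rw [hS', Finset.mem_filter] at hk
        obtain ⟨j1, hj1⟩ := hS k hk.1
        obtain ⟨j2, hj2⟩ := hS _ hk.2
        refine ⟨j2 - j1, ?_⟩
        rw [rpowDiff]
        push_cast at hj2 ⊢
        rw [abs_le] at *
        rw [pow_succ]
        constructor <;> linarith)
    rw [List.prod_cons, Nat.cast_mul] at key
    set N : ℝ := (S.card : ℝ) with hN
    have hN0 : 0 < N := by
      have : 0 < S.card := by omega
      rw [hN]
      exact_mod_cast this
    have hd1' : N * d ≤ 4 * K := by rw [hN]; exact_mod_cast hd1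
    have hd2' : N ^ 2 ≤ 24 * K * (S'.card : ℝ) := by rw [hN]; exact_mod_cast hd2
    have hv3 : v ^ 3 = M ^ (-δ) := by
      rw [hv, ← Real.rpow_natCast, ← Real.rpow_mul hM0.le]
      congr 1; push_cast; ring
    rw [← hv3] at key
    have hcube : N ^ 3 ≤ ((96 * C + 1) * P * K * v) ^ 3 := by
      calc N ^ 3 = N ^ 2 * N := by ring
        _ ≤ 24 * K * (S'.card : ℝ) * N := by gcongr
        _ ≤ 24 * K * (C * (d * P) * K * v ^ 3) * N := by gcongr
        _ = 24 * C * P * K ^ 2 * v ^ 3 * (N * d) := by ring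
        _ ≤ 24 * C * P * K ^ 2 * v ^ 3 * (4 * K) := by gcongr
        _ = (96 * C) * P * (K ^ 3 * v ^ 3) := by ring
        _ ≤ (96 * C + 1) ^ 3 * P ^ 3 * (K ^ 3 * v ^ 3) := by
          have h1 : P ≤ P ^ 3 := le_self_pow₀ hP1 (by norm_num)
          have h2 : 96 * C + 1 ≤ (96 * C + 1) ^ 3 := le_self_pow₀ (by linarith) (by norm_num)
          have h3 : 96 * C ≤ (96 * C + 1) ^ 3 := by linarith
          gcongr
        _ = _ := by ring
    exact le_of_pow_le_pow_left₀ (by norm_num) (by positivity) hcube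

/-- For non-integral `r > 1`, the integer parts `⌊k ^ r⌋` do not concentrate in a residue
class. -/
lemma exists_card_floor_rpow_modEq_le {r : ℝ} (hr : 1 < r) (hri : ∀ m : ℤ, r ≠ m) :
    ∃ C > (0 : ℝ), ∃ δ > (0 : ℝ), ∀ (K e : ℕ) (M : ℝ), 0 < M → M ≤ K → M ≤ e → ∀ c : ℕ,
      (((Finset.Icc 1 K).filter (fun k : ℕ => ⌊(k : ℝ) ^ r⌋₊ ≡ c [MOD e])).card : ℝ) ≤
        C * K * M ^ (-δ) := by
  have hm0 : ((⌊r⌋₊ : ℕ) : ℝ) < r := lt_of_le_of_ne (Nat.floor_le (by linarith))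
    (fun h => hri (⌊r⌋₊ : ℤ) (by rw [Int.cast_natCast]; exact h.symm))
  have hall : ∀ i n : ℕ, n + i = ⌊r⌋₊ → RpowDiffBound r n := by
    intro i
    induction i with
    | zero =>
      rintro n rfl
      exact rpowDiffBound_floor hm0 (Nat.lt_floor_add_one r)
    | succ i ih => exact fun n hn => (ih (n + 1) (by omega)).of_succ
  obtain ⟨C, hC, δ, hδ0, -, H⟩ := hall ⌊r⌋₊ 0 (by simp)
  refine ⟨C + 1, by positivity, δ, hδ0, ?_⟩
  intro K e M hM0 hMK hMe c
  rcases le_total 1 M with hM | hM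
  · have := H K e M hM hMK hMe [] rfl (by simp)
      ((Finset.Icc 1 K).filter (fun k : ℕ => ⌊(k : ℝ) ^ r⌋₊ ≡ c [MOD e]))
      (by
        intro k hk
        simp only [Finset.mem_filter, Finset.mem_Icc] at hk
        simpa using hk.1) c
      (by
        intro k hk
        simp only [Finset.mem_filter, Finset.mem_Icc] at hk
        obtain ⟨j, hj⟩ := (Nat.modEq_iff_dvd.1 hk.2.symm)
        refine ⟨j, ?_⟩
        have hj' : ((⌊(k : ℝ) ^ r⌋₊ : ℝ)) - c = e * j := by exact_mod_cast hj
        rw [rpowDiff, pow_zero, ← hj', abs_le]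
        have h1 := Nat.floor_le (a := (k : ℝ) ^ r) (by positivity)
        have h2 := Nat.lt_floor_add_one ((k : ℝ) ^ r)
        constructor <;> linarith)
    refine this.trans ?_
    simp only [List.prod_nil, Nat.cast_one, mul_one]
    gcongr
    linarith
  · have h1 : (((Finset.Icc 1 K).filter
        (fun k : ℕ => ⌊(k : ℝ) ^ r⌋₊ ≡ c [MOD e])).card : ℝ) ≤ K := by
      exact_mod_cast (Finset.card_filter_le _ _).trans (by simp)
    have h2 : 1 ≤ M ^ (-δ) := Real.one_le_rpow_of_pos_of_le_one_of_nonpos hM0 hM (by linarith)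
    calc _ ≤ (K : ℝ) := h1
      _ = 1 * K * 1 := by ring
      _ ≤ (C + 1) * K * M ^ (-δ) := by gcongr; linarith

open scoped ArithmeticFunction.Moebius in
lemma sum_moebius_of_dvd_of_dvd {k l : ℕ} (hk : Squarefree k) :
    ∑ d ∈ k.divisors.filter (fun d => l ∣ d), (μ d : ℝ) = if k = l then (μ l : ℝ) else 0 := by
  have hk0 : k ≠ 0 := hk.ne_zero
  by_cases hl : l ∣ k
  · obtain ⟨m, rfl⟩ := hl
    have hl0 : l ≠ 0 := left_ne_zero_of_mul hk0
    have hm0 : m ≠ 0 := right_ne_zero_of_mul hk0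
    have himg : (l * m).divisors.filter (fun d => l ∣ d) = m.divisors.image (fun e => l * e) := by
      ext d
      simp only [Finset.mem_filter, Nat.mem_divisors, Finset.mem_image]
      constructor
      · rintro ⟨⟨h1, _⟩, e, rfl⟩
        exact ⟨e, ⟨Nat.dvd_of_mul_dvd_mul_left (Nat.pos_of_ne_zero hl0) h1, hm0⟩, rfl⟩
      · rintro ⟨e, ⟨h1, _⟩, rfl⟩
        exact ⟨⟨Nat.mul_dvd_mul_left l h1, hk0⟩, Dvd.intro _ rfl⟩
    rw [himg, Finset.sum_image (fun a _ b _ h => Nat.eq_of_mul_eq_mul_left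
      (Nat.pos_of_ne_zero hl0) h)]
    have hcop : ∀ e ∈ m.divisors, (μ (l * e) : ℝ) = μ l * μ e := by
      intro e he
      have h1 := (Nat.squarefree_mul_iff.1 hk).1
      have h2 : l.Coprime e := h1.coprime_dvd_right (Nat.dvd_of_mem_divisors he)
      rw [ArithmeticFunction.isMultiplicative_moebius.map_mul_of_coprime h2]
      push_cast; ring
    rw [Finset.sum_congr rfl hcop, ← Finset.mul_sum]
    have h3 : ∑ e ∈ m.divisors, (μ e : ℝ) = if m = 1 then 1 else 0 := by
      have := congrArg (fun f => f m) ArithmeticFunction.coe_zeta_mul_moebius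
      simp only [ArithmeticFunction.coe_zeta_mul_apply, ArithmeticFunction.one_apply] at this
      exact_mod_cast this
    rw [h3]
    by_cases hm : m = 1
    · simp [hm]
    · have : l * m ≠ l := fun h => hm (by simpa [hl0] using h)
      simp [hm, this]
  · have h1 : k.divisors.filter (fun d => l ∣ d) = ∅ := by
      ext d
      simp only [Finset.mem_filter, Nat.mem_divisors, Finset.notMem_empty, iff_false]
      rintro ⟨⟨h1, _⟩, h2⟩
      exact hl (h2.trans h1)
    have h2 : k ≠ l := by rintro rfl; exact hl dvd_rfl
    simp [h1, h2]

namespace BoundingSieve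

variable (s : BoundingSieve) (z : ℕ)

/-- The divisors of the sifting modulus up to `z`. -/
noncomputable def smallDivisors : Finset ℕ := s.prodPrimes.divisors.filter (fun d => d ≤ z)

/-- The sum of the Selberg terms up to `z`. -/
noncomputable def selbergSum : ℝ := ∑ l ∈ s.smallDivisors z, s.selbergTerms l

open scoped ArithmeticFunction.Moebius in
/-- The optimal weights in the `Λ²` sieve. -/
noncomputable def selbergWeights (d : ℕ) : ℝ :=
  (s.nu d)⁻¹ * μ d *
    ((∑ l ∈ (s.smallDivisors z).filter (fun l => d ∣ l), s.selbergTerms l) / s.selbergSum z)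

variable {s z}

lemma dvd_of_mem_smallDivisors {d : ℕ} (hd : d ∈ s.smallDivisors z) : d ∣ s.prodPrimes :=
  Nat.dvd_of_mem_divisors (Finset.mem_filter.1 hd).1

lemma selbergSum_pos (hz : 1 ≤ z) : 0 < s.selbergSum z := by
  refine Finset.sum_pos (fun l hl => selbergTerms_pos (dvd_of_mem_smallDivisors hl)) ⟨1, ?_⟩
  simp [smallDivisors, hz, prodPrimes_ne_zero]

lemma selbergWeights_one (hz : 1 ≤ z) : s.selbergWeights z 1 = 1 := by
  have h : (s.smallDivisors z).filter (fun l => 1 ∣ l) = s.smallDivisors z := by simp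
  rw [selbergWeights, h, s.nu_mult.map_one, ← selbergSum, div_self (selbergSum_pos hz).ne']
  simp

open scoped ArithmeticFunction.Moebius in
lemma sum_nu_mul_selbergWeights {l : ℕ} (hl : l ∣ s.prodPrimes) :
    (∑ d ∈ s.prodPrimes.divisors, if l ∣ d then s.nu d * s.selbergWeights z d else 0) =
      if l ≤ z then μ l * s.selbergTerms l / s.selbergSum z else 0 := by
  have h1 : ∀ d ∈ s.prodPrimes.divisors,
      (if l ∣ d then s.nu d * s.selbergWeights z d else 0) =
      (∑ k ∈ s.smallDivisors z,
        if l ∣ d ∧ d ∣ k then (μ d : ℝ) * s.selbergTerms k else 0) / s.selbergSum z := by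
    intro d hd
    have hnu : s.nu d ≠ 0 := nu_ne_zero (Nat.dvd_of_mem_divisors hd)
    by_cases hld : l ∣ d
    · simp only [hld, if_true, true_and, ← Finset.sum_filter, ← Finset.mul_sum, selbergWeights]
      field_simp
    · simp [hld]
  rw [Finset.sum_congr rfl h1, ← Finset.sum_div, Finset.sum_comm]
  have h2 : ∀ k ∈ s.smallDivisors z,
      (∑ d ∈ s.prodPrimes.divisors,
        if l ∣ d ∧ d ∣ k then (μ d : ℝ) * s.selbergTerms k else 0) =
      if k = l then μ l * s.selbergTerms l else 0 := by
    intro k hk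
    have hkP := dvd_of_mem_smallDivisors hk
    have := sum_moebius_of_dvd_of_dvd (l := l) (squarefree_of_dvd_prodPrimes hkP)
    rw [← Finset.sum_filter]
    have h3 : s.prodPrimes.divisors.filter (fun d => l ∣ d ∧ d ∣ k) =
        k.divisors.filter (fun d => l ∣ d) := by
      ext d
      simp only [Finset.mem_filter, Nat.mem_divisors]
      constructor
      · rintro ⟨_, h, h'⟩
        exact ⟨⟨h', (squarefree_of_dvd_prodPrimes hkP).ne_zero⟩, h⟩
      · rintro ⟨⟨h', _⟩, h⟩
        exact ⟨⟨h'.trans hkP, prodPrimes_ne_zero⟩, h, h'⟩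
    rw [h3, ← Finset.sum_mul, this]
    split_ifs with h
    · rw [h]
    · simp
  rw [Finset.sum_congr rfl h2, Finset.sum_ite_eq']
  have h4 : l ∈ s.smallDivisors z ↔ l ≤ z := by
    simp [smallDivisors, hl, prodPrimes_ne_zero]
  by_cases h : l ≤ z
  · simp [h4, h]
  · simp [h4, h]

lemma mainSum_selbergWeights (hz : 1 ≤ z) :
    s.mainSum (lambdaSquared (s.selbergWeights z)) = (s.selbergSum z)⁻¹ := by
  have hV := (selbergSum_pos (s := s) hz).ne'
  rw [mainSum_lambdaSquared_eq_sum_mul_sum_sq]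
  have h1 : ∀ l ∈ s.prodPrimes.divisors, (s.selbergTerms l)⁻¹ *
      (∑ d ∈ s.prodPrimes.divisors, if l ∣ d then s.nu d * s.selbergWeights z d else 0) ^ 2 =
      if l ≤ z then s.selbergTerms l / s.selbergSum z ^ 2 else 0 := by
    intro l hl
    have hlP := Nat.dvd_of_mem_divisors hl
    have hg := (selbergTerms_pos hlP).ne'
    rw [sum_nu_mul_selbergWeights hlP]
    split_ifs with h
    · have hmu : ((ArithmeticFunction.moebius l : ℤ) : ℝ) ^ 2 = 1 := by
        have := ArithmeticFunction.moebius_sq_eq_one_of_squarefree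
          (squarefree_of_dvd_prodPrimes hlP)
        exact_mod_cast this
      rw [div_pow, mul_pow, hmu]
      field_simp
    · simp
  rw [Finset.sum_congr rfl h1, ← Finset.sum_filter, ← Finset.sum_div]
  change s.selbergSum z / _ = _
  field_simp

lemma abs_selbergWeights_le (hz : 1 ≤ z) {d : ℕ} (hd : d ∣ s.prodPrimes) :
    |s.selbergWeights z d| ≤ if d ≤ z then (s.nu d)⁻¹ else 0 := by
  have hV := selbergSum_pos (s := s) hz
  have hnu := nu_pos_of_dvd_prodPrimes hd
  split_ifs with h
  · rw [selbergWeights, abs_mul, abs_mul, abs_of_pos (inv_pos.2 hnu)]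
    have h1 : |((ArithmeticFunction.moebius d : ℤ) : ℝ)| ≤ 1 := by
      exact_mod_cast ArithmeticFunction.abs_moebius_le_one
    have h2 : |(∑ l ∈ (s.smallDivisors z).filter (fun l => d ∣ l), s.selbergTerms l) /
        s.selbergSum z| ≤ 1 := by
      rw [abs_div, abs_of_pos hV, div_le_one hV, abs_of_nonneg
        (Finset.sum_nonneg fun l hl => (selbergTerms_pos
          (dvd_of_mem_smallDivisors (Finset.mem_filter.1 hl).1)).le)]
      exact Finset.sum_le_sum_of_subset_of_nonneg (Finset.filter_subset _ _)
        fun l hl _ => (selbergTerms_pos (dvd_of_mem_smallDivisors hl)).le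
    calc _ ≤ (s.nu d)⁻¹ * 1 * 1 := by gcongr
      _ = _ := by ring
  · have : (s.smallDivisors z).filter (fun l => d ∣ l) = ∅ := by
      ext l
      simp only [smallDivisors, Finset.mem_filter, Nat.mem_divisors, Finset.notMem_empty,
        iff_false]
      rintro ⟨⟨⟨h1, h2⟩, h3⟩, h4⟩
      exact h ((Nat.le_of_dvd (Nat.pos_of_ne_zero (ne_zero_of_dvd_ne_zero h2 h1)) h4).trans h3)
    simp [selbergWeights, this]

lemma errSum_lambdaSquared_le (w : ℕ → ℝ) :
    s.errSum (lambdaSquared w) ≤ ∑ d₁ ∈ s.prodPrimes.divisors, ∑ d₂ ∈ s.prodPrimes.divisors,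
      |w d₁| * |w d₂| * |s.rem (d₁.lcm d₂)| := by
  calc s.errSum (lambdaSquared w) ≤ ∑ d ∈ s.prodPrimes.divisors, ∑ d₁ ∈ s.prodPrimes.divisors,
      ∑ d₂ ∈ s.prodPrimes.divisors,
        if d = d₁.lcm d₂ then |w d₁| * |w d₂| * |s.rem (d₁.lcm d₂)| else 0 := by
        rw [errSum]
        refine Finset.sum_le_sum fun d hd => ?_
        have hsub : d.divisors ⊆ s.prodPrimes.divisors :=
          Nat.divisors_subset_of_dvd prodPrimes_ne_zero (Nat.dvd_of_mem_divisors hd)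
        calc |lambdaSquared w d| * |s.rem d| ≤ (∑ d₁ ∈ d.divisors, ∑ d₂ ∈ d.divisors,
              if d = d₁.lcm d₂ then |w d₁| * |w d₂| else 0) * |s.rem d| := by
              gcongr
              rw [lambdaSquared]
              refine (Finset.abs_sum_le_sum_abs _ _).trans (Finset.sum_le_sum fun d₁ _ => ?_)
              refine (Finset.abs_sum_le_sum_abs _ _).trans (Finset.sum_le_sum fun d₂ _ => ?_)
              split_ifs
              · rw [abs_mul]
              · simp
          _ = ∑ d₁ ∈ d.divisors, ∑ d₂ ∈ d.divisors,
              if d = d₁.lcm d₂ then |w d₁| * |w d₂| * |s.rem (d₁.lcm d₂)| else 0 := by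
              rw [Finset.sum_mul]
              refine Finset.sum_congr rfl fun d₁ _ => ?_
              rw [Finset.sum_mul]
              refine Finset.sum_congr rfl fun d₂ _ => ?_
              split_ifs with h
              · rw [← h]
              · simp
          _ ≤ _ := by
              refine (Finset.sum_le_sum fun d₁ _ => Finset.sum_le_sum_of_subset_of_nonneg hsub
                fun _ _ _ => by positivity).trans ?_
              exact Finset.sum_le_sum_of_subset_of_nonneg hsub
                fun _ _ _ => Finset.sum_nonneg fun _ _ => by positivity
    _ = _ := by
        rw [Finset.sum_comm]
        refine Finset.sum_congr rfl fun d₁ h₁ => ?_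
        rw [Finset.sum_comm]
        refine Finset.sum_congr rfl fun d₂ h₂ => ?_
        rw [Finset.sum_ite_eq', if_pos]
        exact Nat.mem_divisors.2 ⟨Nat.lcm_dvd (Nat.dvd_of_mem_divisors h₁)
          (Nat.dvd_of_mem_divisors h₂), prodPrimes_ne_zero⟩

/-- Selberg's upper bound sieve, with a crude error term. -/
theorem siftedSum_le_of_rem_le (hz : 1 ≤ z) (hnu : ∀ d, d ∣ s.prodPrimes → (s.nu d)⁻¹ ≤ d)
    (hrem : ∀ d, d ∣ s.prodPrimes → |s.rem d| ≤ d) :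
    s.siftedSum ≤ s.totalMass / s.selbergSum z + (z : ℝ) ^ 6 := by
  refine (siftedSum_le_mainSum_errSum_of_upperMoebius (s := s)
    (lambdaSquared (s.selbergWeights z))
    (upperMoebius_lambdaSquared (s.selbergWeights z) (selbergWeights_one hz))).trans ?_
  rw [mainSum_selbergWeights hz, ← div_eq_mul_inv]
  gcongr
  refine (errSum_lambdaSquared_le _).trans ?_
  have hcard : ((s.smallDivisors z).card : ℝ) ≤ z := by
    have : s.smallDivisors z ⊆ Finset.Icc 1 z := by
      intro d hd
      rw [smallDivisors, Finset.mem_filter] at hd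
      exact Finset.mem_Icc.2 ⟨Nat.pos_of_mem_divisors hd.1, hd.2⟩
    have := Finset.card_le_card this
    rw [Nat.card_Icc] at this
    exact_mod_cast this
  calc _ ≤ ∑ d₁ ∈ s.prodPrimes.divisors, ∑ d₂ ∈ s.prodPrimes.divisors,
        if d₁ ≤ z then (if d₂ ≤ z then (z : ℝ) ^ 4 else 0) else 0 := by
        refine Finset.sum_le_sum fun d₁ h₁ => Finset.sum_le_sum fun d₂ h₂ => ?_
        have hd₁ := Nat.dvd_of_mem_divisors h₁
        have hd₂ := Nat.dvd_of_mem_divisors h₂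
        have e₁ := abs_selbergWeights_le hz hd₁
        have e₂ := abs_selbergWeights_le hz hd₂
        by_cases c₁ : d₁ ≤ z
        · by_cases c₂ : d₂ ≤ z
          · rw [if_pos c₁] at e₁ ⊢
            rw [if_pos c₂] at e₂ ⊢
            have c₁' : (d₁ : ℝ) ≤ z := by exact_mod_cast c₁
            have c₂' : (d₂ : ℝ) ≤ z := by exact_mod_cast c₂
            have f₁ : |s.selbergWeights z d₁| ≤ z := (e₁.trans (hnu _ hd₁)).trans c₁'
            have f₂ : |s.selbergWeights z d₂| ≤ z := (e₂.trans (hnu _ hd₂)).trans c₂'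
            have f₃ : |s.rem (d₁.lcm d₂)| ≤ (z : ℝ) * z := by
              refine (hrem _ (Nat.lcm_dvd hd₁ hd₂)).trans ?_
              have : d₁.lcm d₂ ≤ d₁ * d₂ := Nat.le_of_dvd
                (Nat.mul_pos (Nat.pos_of_mem_divisors h₁) (Nat.pos_of_mem_divisors h₂))
                (Nat.lcm_dvd_mul d₁ d₂)
              calc ((d₁.lcm d₂ : ℕ) : ℝ) ≤ d₁ * d₂ := by exact_mod_cast this
                _ ≤ z * z := by gcongr
            calc _ ≤ (z : ℝ) * z * (z * z) := by gcongr
              _ = _ := by ring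
          · rw [if_neg c₂] at e₂ ⊢
            simp [abs_nonpos_iff.1 e₂]
        · rw [if_neg c₁] at e₁ ⊢
          simp [abs_nonpos_iff.1 e₁]
    _ = (s.smallDivisors z).card * ((s.smallDivisors z).card * (z : ℝ) ^ 4) := by
        have h : ∀ d₁ ∈ s.prodPrimes.divisors, (∑ d₂ ∈ s.prodPrimes.divisors,
            if d₁ ≤ z then (if d₂ ≤ z then (z : ℝ) ^ 4 else 0) else 0) =
            if d₁ ≤ z then (s.smallDivisors z).card * (z : ℝ) ^ 4 else 0 := by
          intro d₁ _
          split_ifs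
          · rw [← Finset.sum_filter, Finset.sum_const, nsmul_eq_mul, smallDivisors]
          · simp
        rw [Finset.sum_congr rfl h, ← Finset.sum_filter, Finset.sum_const, nsmul_eq_mul,
          smallDivisors]
    _ ≤ z * (z * (z : ℝ) ^ 4) := by gcongr
    _ = _ := by ring

end BoundingSieve

/-- The completely multiplicative function equal to `2 ^ Ω(n) / n` at odd `n` and vanishing at
even `n`. -/
noncomputable def oddTwoPow : ℕ →* ℝ where
  toFun n := if Odd n then 2 ^ ArithmeticFunction.cardFactors n / n else 0
  map_one' := by simp
  map_mul' m n := by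
    by_cases hm : Odd m
    · by_cases hn : Odd n
      · rw [if_pos hm, if_pos hn, if_pos (hm.mul hn),
          ArithmeticFunction.cardFactors_mul hm.pos.ne' hn.pos.ne', pow_add]
        push_cast
        rw [mul_div_mul_comm]
      · simp [Nat.odd_mul, hn]
    · simp [Nat.odd_mul, hm]

lemma oddTwoPow_apply (n : ℕ) :
    oddTwoPow n = if Odd n then (2 : ℝ) ^ ArithmeticFunction.cardFactors n / n else 0 := rfl

lemma oddTwoPow_of_odd {n : ℕ} (hn : Odd n) :
    oddTwoPow n = 2 ^ ArithmeticFunction.cardFactors n / n := if_pos hn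

lemma oddTwoPow_two : oddTwoPow 2 = 0 := by
  rw [oddTwoPow_apply, if_neg (by decide)]

lemma oddTwoPow_zero : oddTwoPow 0 = 0 := by
  rw [oddTwoPow_apply, if_neg (by decide)]

lemma oddTwoPow_nonneg (n : ℕ) : 0 ≤ oddTwoPow n := by
  rw [oddTwoPow_apply]
  split_ifs <;> positivity

lemma oddTwoPow_prime {p : ℕ} (hp : p.Prime) (hp2 : p ≠ 2) : oddTwoPow p = 2 / p := by
  rw [oddTwoPow_of_odd (hp.odd_of_ne_two hp2), ArithmeticFunction.cardFactors_apply_prime hp,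
    pow_one]

lemma oddTwoPow_prime_lt_one {p : ℕ} (hp : p.Prime) : oddTwoPow p < 1 := by
  rcases eq_or_ne p 2 with rfl | h
  · rw [oddTwoPow_two]; norm_num
  · rw [oddTwoPow_prime hp h, div_lt_one (by exact_mod_cast hp.pos)]
    exact_mod_cast lt_of_le_of_ne hp.two_le h.symm

lemma card_divisors_le_two_pow_cardFactors {n : ℕ} (hn : n ≠ 0) :
    n.divisors.card ≤ 2 ^ ArithmeticFunction.cardFactors n := by
  induction n using induction_on_primes with
  | zero => exact absurd rfl hn
  | one => simp
  | prime_mul p a hp ih =>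
    have ha : a ≠ 0 := right_ne_zero_of_mul hn
    rw [ArithmeticFunction.cardFactors_mul hp.ne_zero ha,
      ArithmeticFunction.cardFactors_apply_prime hp, pow_add, pow_one, Nat.divisors_mul]
    refine Finset.card_mul_le.trans (Nat.mul_le_mul ?_ (ih ha))
    rw [hp.divisors]
    exact Finset.card_le_two

lemma cardDivisors_div_le_oddTwoPow {n : ℕ} (hn : Odd n) :
    (n.divisors.card : ℝ) / n ≤ oddTwoPow n := by
  rw [oddTwoPow_of_odd hn]
  gcongr
  exact_mod_cast card_divisors_le_two_pow_cardFactors hn.pos.ne'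

/-- The sum of `oddTwoPow` over numbers with a given radical. -/
lemma sum_oddTwoPow_radical_le {l : ℕ} (S : Finset ℕ)
    (hS : ∀ n ∈ S, n ≠ 0 ∧ ∏ p ∈ n.primeFactors, p = l) :
    ∑ n ∈ S, oddTwoPow n ≤ oddTwoPow l * ∏ p ∈ l.primeFactors, (1 - oddTwoPow p)⁻¹ := by
  rcases S.eq_empty_or_nonempty with rfl | ⟨n₀, hn₀⟩
  · rw [Finset.sum_empty]
    refine mul_nonneg (oddTwoPow_nonneg _) (Finset.prod_nonneg fun p hp => inv_nonneg.2 ?_)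
    linarith [oddTwoPow_prime_lt_one (Nat.prime_of_mem_primeFactors hp)]
  have hl : 0 < l := by
    rw [← (hS _ hn₀).2]
    exact Nat.pos_of_ne_zero (Finset.prod_ne_zero_iff.2
      fun p hp => (Nat.prime_of_mem_primeFactors hp).ne_zero)
  have hfac : ∀ n ∈ S, n.primeFactors = l.primeFactors := by
    intro n hn
    rw [← (hS n hn).2, Nat.primeFactors_prod fun p hp => Nat.prime_of_mem_primeFactors hp]
  have hdvd : ∀ n ∈ S, l ∣ n := fun n hn => by
    rw [← (hS n hn).2]; exact Nat.prod_primeFactors_dvd n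
  have key := EulerProduct.summable_and_hasSum_factoredNumbers_prod_filter_prime_geometric
    (f := oddTwoPow) (fun {p} hp => by
      rw [Real.norm_of_nonneg (oddTwoPow_nonneg p)]; exact oddTwoPow_prime_lt_one hp)
    l.primeFactors
  have hfilter : l.primeFactors.filter Nat.Prime = l.primeFactors :=
    Finset.filter_true_of_mem fun p hp => Nat.prime_of_mem_primeFactors hp
  rw [hfilter] at key
  have hmem : ∀ n ∈ S, n / l ∈ Nat.factoredNumbers l.primeFactors := by
    intro n hn
    have hpos : n / l ≠ 0 := (Nat.div_pos (Nat.le_of_dvd (Nat.pos_of_ne_zero (hS n hn).1)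
      (hdvd n hn)) hl).ne'
    refine Nat.mem_factoredNumbers_of_primeFactors_subset hpos ?_
    rw [← hfac n hn]
    exact Nat.primeFactors_mono (Nat.div_dvd_of_dvd (hdvd n hn)) (hS n hn).1
  calc ∑ n ∈ S, oddTwoPow n = oddTwoPow l * ∑ n ∈ S, oddTwoPow (n / l) := by
        rw [Finset.mul_sum]
        refine Finset.sum_congr rfl fun n hn => ?_
        rw [← map_mul, Nat.mul_div_cancel' (hdvd n hn)]
    _ ≤ _ := by
        refine mul_le_mul_of_nonneg_left ?_ (oddTwoPow_nonneg _)
        let T : Finset (Nat.factoredNumbers l.primeFactors) :=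
          S.attach.image fun n => ⟨n.1 / l, hmem n.1 n.2⟩
        have hT : ∑ n ∈ S, oddTwoPow (n / l) = ∑ m ∈ T, oddTwoPow m := by
          rw [Finset.sum_image, Finset.sum_attach S (fun n => oddTwoPow (n / l))]
          intro a _ b _ hab
          have h1 : a.1 / l = b.1 / l := congrArg Subtype.val hab
          ext
          rw [← Nat.mul_div_cancel' (hdvd a.1 a.2), h1, Nat.mul_div_cancel' (hdvd b.1 b.2)]
        rw [hT]
        exact sum_le_hasSum T (fun m _ => oddTwoPow_nonneg _) key.2

/-- Removing the multiples of a prime from a harmonic sum. -/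
lemma mul_prod_le_sum_inv_not_dvd (Y : ℕ) (S : Finset ℕ) (hS : ∀ p ∈ S, p.Prime) :
    (∑ n ∈ Finset.Icc 1 Y, (n : ℝ)⁻¹) * ∏ p ∈ S, (1 - (p : ℝ)⁻¹) ≤
      ∑ n ∈ (Finset.Icc 1 Y).filter (fun n => ∀ p ∈ S, ¬ p ∣ n), (n : ℝ)⁻¹ := by
  induction S using Finset.induction with
  | empty => simp
  | insert q S hq ih =>
    have hqp : q.Prime := hS q (Finset.mem_insert_self _ _)
    have hq0 : (0 : ℝ) < q := by exact_mod_cast hqp.pos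
    have hq1 : 0 ≤ 1 - (q : ℝ)⁻¹ := by
      have : (q : ℝ)⁻¹ ≤ 1 := inv_le_one_of_one_le₀ (by exact_mod_cast hqp.one_le)
      linarith
    have h := ih fun p hp => hS p (Finset.mem_insert_of_mem hp)
    rw [Finset.prod_insert hq]
    set F := (Finset.Icc 1 Y).filter (fun n => ∀ p ∈ S, ¬ p ∣ n) with hF
    have hsplit : ∑ n ∈ F, (n : ℝ)⁻¹ = ∑ n ∈ F.filter (fun n => ¬ q ∣ n), (n : ℝ)⁻¹ +
        ∑ n ∈ F.filter (fun n => q ∣ n), (n : ℝ)⁻¹ := by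
      rw [add_comm, Finset.sum_filter_add_sum_filter_not]
    have hmult : ∑ n ∈ F.filter (fun n => q ∣ n), (n : ℝ)⁻¹ ≤
        (q : ℝ)⁻¹ * ∑ n ∈ F, (n : ℝ)⁻¹ := by
      calc ∑ n ∈ F.filter (fun n => q ∣ n), (n : ℝ)⁻¹
          = ∑ n ∈ F.filter (fun n => q ∣ n), (q : ℝ)⁻¹ * ((n / q : ℕ) : ℝ)⁻¹ := by
            refine Finset.sum_congr rfl fun n hn => ?_
            obtain ⟨m, rfl⟩ := (Finset.mem_filter.1 hn).2
            rw [Nat.mul_div_cancel_left _ hqp.pos]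
            push_cast
            rw [mul_inv]
        _ = (q : ℝ)⁻¹ * ∑ m ∈ (F.filter (fun n => q ∣ n)).image (· / q), (m : ℝ)⁻¹ := by
            rw [Finset.sum_image, Finset.mul_sum]
            intro a ha b hb hab
            have ha' := (Finset.mem_filter.1 ha).2
            have hb' := (Finset.mem_filter.1 hb).2
            rw [← Nat.mul_div_cancel' ha', show a / q = b / q from hab, Nat.mul_div_cancel' hb']
        _ ≤ _ := by
            refine mul_le_mul_of_nonneg_left (Finset.sum_le_sum_of_subset_of_nonneg ?_
              fun _ _ _ => by positivity) (by positivity)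
            intro m hm
            obtain ⟨n, hn, rfl⟩ := Finset.mem_image.1 hm
            obtain ⟨hn, ⟨m, rfl⟩⟩ := Finset.mem_filter.1 hn
            rw [Nat.mul_div_cancel_left _ hqp.pos]
            rw [hF, Finset.mem_filter, Finset.mem_Icc] at hn ⊢
            obtain ⟨⟨h1, h2⟩, h3⟩ := hn
            refine ⟨⟨Nat.pos_of_ne_zero fun h => by simp [h] at h1,
              (Nat.le_mul_of_pos_left m hqp.pos).trans h2⟩,
              fun p hp hd => h3 p hp (hd.mul_left q)⟩
    have hset : (Finset.Icc 1 Y).filter (fun n => ∀ p ∈ insert q S, ¬ p ∣ n) =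
        F.filter (fun n => ¬ q ∣ n) := by
      ext n
      simp only [hF, Finset.mem_filter, Finset.forall_mem_insert]
      tauto
    rw [hset]
    calc _ = ((∑ n ∈ Finset.Icc 1 Y, (n : ℝ)⁻¹) * ∏ p ∈ S, (1 - (p : ℝ)⁻¹)) *
          (1 - (q : ℝ)⁻¹) := by ring
      _ ≤ (∑ n ∈ F, (n : ℝ)⁻¹) * (1 - (q : ℝ)⁻¹) := by gcongr
      _ ≤ _ := by linarith

lemma exp_neg_two_mul_le {x : ℝ} (h0 : 0 ≤ x) (h1 : x ≤ 1 / 2) : Real.exp (-(2 * x)) ≤ 1 - x := by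
  rw [Real.exp_neg]
  refine inv_le_of_inv_le₀ (by linarith) ?_
  calc (1 - x)⁻¹ ≤ 2 * x + 1 := by
        rw [inv_le_iff_one_le_mul₀ (by linarith)]
        nlinarith
    _ ≤ _ := Real.add_one_le_exp _

lemma log_mul_exp_le_sum_inv_not_dvd (Y : ℕ) (S : Finset ℕ) (hS : ∀ p ∈ S, p.Prime) :
    Real.log (Y + 1) * Real.exp (-(2 * ∑ p ∈ S, (p : ℝ)⁻¹)) ≤
      ∑ n ∈ (Finset.Icc 1 Y).filter (fun n => ∀ p ∈ S, ¬ p ∣ n), (n : ℝ)⁻¹ := by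
  refine le_trans ?_ (mul_prod_le_sum_inv_not_dvd Y S hS)
  have h1 : Real.log (Y + 1) ≤ ∑ n ∈ Finset.Icc 1 Y, (n : ℝ)⁻¹ := by
    have := log_add_one_le_harmonic Y
    rw [harmonic_eq_sum_Icc] at this
    push_cast at this
    exact_mod_cast this
  have h2 : Real.exp (-(2 * ∑ p ∈ S, (p : ℝ)⁻¹)) ≤ ∏ p ∈ S, (1 - (p : ℝ)⁻¹) := by
    rw [Finset.mul_sum, ← Finset.sum_neg_distrib, Real.exp_sum]
    refine Finset.prod_le_prod (fun _ _ => (Real.exp_pos _).le) fun p hp => ?_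
    refine exp_neg_two_mul_le (by positivity) ?_
    rw [one_div]
    exact inv_anti₀ (by norm_num) (by exact_mod_cast (hS p hp).two_le)
  have h3 : 0 ≤ ∑ n ∈ Finset.Icc 1 Y, (n : ℝ)⁻¹ := Finset.sum_nonneg fun _ _ => by positivity
  gcongr

/-- A lower bound for the sum of `oddTwoPow` over the numbers up to `y ^ 2` coprime to `2 * h`. -/
lemma log_sq_mul_exp_le_sum_oddTwoPow (y : ℕ) {h : ℕ} (hh : 0 < h) :
    Real.log (y + 1) ^ 2 * Real.exp (-(4 * ∑ p ∈ (2 * h).primeFactors, (p : ℝ)⁻¹)) ≤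
      ∑ n ∈ (Finset.Icc 1 (y ^ 2)).filter (fun n => n.Coprime (2 * h)), oddTwoPow n := by
  set S := (2 * h).primeFactors with hS
  have hSp : ∀ p ∈ S, p.Prime := fun p hp => Nat.prime_of_mem_primeFactors hp
  set G := (Finset.Icc 1 y).filter (fun n => ∀ p ∈ S, ¬ p ∣ n) with hG
  set F := (Finset.Icc 1 (y ^ 2)).filter (fun n => n.Coprime (2 * h)) with hF
  have h1 := log_mul_exp_le_sum_inv_not_dvd y S hSp
  have h0 : 0 ≤ Real.log (y + 1) * Real.exp (-(2 * ∑ p ∈ S, (p : ℝ)⁻¹)) :=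
    mul_nonneg (Real.log_nonneg (by linarith [(Nat.cast_nonneg y : (0 : ℝ) ≤ y)]))
      (Real.exp_pos _).le
  have hmaps : ∀ q ∈ G ×ˢ G, q.1 * q.2 ∈ F := by
    rintro ⟨a, b⟩ hq
    simp only [hG, Finset.mem_product, Finset.mem_filter, Finset.mem_Icc] at hq
    obtain ⟨⟨⟨a1, a2⟩, a3⟩, ⟨b1, b2⟩, b3⟩ := hq
    simp only [hF, Finset.mem_filter, Finset.mem_Icc]
    refine ⟨⟨Nat.mul_pos a1 b1, by rw [sq]; exact Nat.mul_le_mul a2 b2⟩,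
      Nat.coprime_of_dvd fun p hp hd hd' => ?_⟩
    have hp : p ∈ S := Nat.mem_primeFactors.2 ⟨hp, hd', by omega⟩
    rcases (hSp p hp).dvd_mul.1 hd with hd | hd
    exacts [a3 p hp hd, b3 p hp hd]
  calc _ = (Real.log (y + 1) * Real.exp (-(2 * ∑ p ∈ S, (p : ℝ)⁻¹))) ^ 2 := by
        rw [mul_pow, ← Real.exp_nat_mul]
        congr 2
        push_cast
        ring
    _ ≤ (∑ n ∈ G, (n : ℝ)⁻¹) ^ 2 := by gcongr
    _ = ∑ q ∈ G ×ˢ G, ((q.1 * q.2 : ℕ) : ℝ)⁻¹ := by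
        rw [sq, Finset.sum_mul_sum, Finset.sum_product]
        push_cast
        simp_rw [mul_inv]
    _ = ∑ n ∈ F, ∑ q ∈ (G ×ˢ G).filter (fun q => q.1 * q.2 = n), ((q.1 * q.2 : ℕ) : ℝ)⁻¹ :=
        (Finset.sum_fiberwise_of_maps_to hmaps _).symm
    _ ≤ ∑ n ∈ F, oddTwoPow n := by
        refine Finset.sum_le_sum fun n hn => ?_
        rw [hF, Finset.mem_filter, Finset.mem_Icc] at hn
        have hodd : Odd n := Nat.coprime_two_right.1 (hn.2.coprime_dvd_right (Dvd.intro _ rfl))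
        refine le_trans ?_ (cardDivisors_div_le_oddTwoPow hodd)
        have hcard : ((G ×ˢ G).filter (fun q => q.1 * q.2 = n)).card ≤ n.divisors.card := by
          refine Finset.card_le_card_of_injOn Prod.fst ?_ ?_
          · intro q hq
            exact Nat.mem_divisors.2 ⟨Dvd.intro _ (Finset.mem_filter.1 hq).2, by omega⟩
          · rintro ⟨a, b⟩ hq ⟨a', b'⟩ hq' (rfl : a = a')
            have e1 := (Finset.mem_filter.1 hq).2
            have e2 := (Finset.mem_filter.1 hq').2
            have ha : 0 < a := Nat.pos_of_ne_zero fun h => by simp [h] at e1; omega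
            simp only at e1 e2
            have : b = b' := Nat.eq_of_mul_eq_mul_left ha (e1.trans e2.symm)
            rw [this]
        calc _ = ∑ q ∈ (G ×ˢ G).filter (fun q => q.1 * q.2 = n), (n : ℝ)⁻¹ :=
              Finset.sum_congr rfl fun q hq => by rw [(Finset.mem_filter.1 hq).2]
          _ = (((G ×ˢ G).filter (fun q => q.1 * q.2 = n)).card : ℝ) / n := by
              rw [Finset.sum_const, nsmul_eq_mul, div_eq_mul_inv]
          _ ≤ _ := by gcongr

lemma natCard_zmod_mul_add_eq_zero_prime {p h : ℕ} (hp : p.Prime) (hph : ¬ p ∣ h) :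
    Nat.card {x : ZMod p // x * (x + h) = 0} = 2 := by
  have := Fact.mk hp
  have h0 : (h : ZMod p) ≠ 0 := fun h0 => hph ((ZMod.natCast_eq_zero_iff _ _).1 h0)
  have : {x : ZMod p | x * (x + h) = 0} = {0, -(h : ZMod p)} := by
    ext x
    simp [add_eq_zero_iff_eq_neg]
  change Nat.card ({x : ZMod p | x * (x + h) = 0} : Set _) = 2
  rw [this, Nat.card_coe_set_eq, Set.ncard_pair (by simpa [eq_comm] using h0)]

lemma natCard_zmod_mul_add_eq_zero_mul {m n h : ℕ} (hmn : m.Coprime n) :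
    Nat.card {x : ZMod (m * n) // x * (x + h) = 0} =
      Nat.card {x : ZMod m // x * (x + h) = 0} * Nat.card {x : ZMod n // x * (x + h) = 0} := by
  rw [← Nat.card_prod]
  let e := ZMod.chineseRemainder hmn
  have e1 : {x : ZMod (m * n) // x * (x + h) = 0} ≃
      {y : ZMod m × ZMod n // y.1 * (y.1 + h) = 0 ∧ y.2 * (y.2 + h) = 0} := by
    refine e.toEquiv.subtypeEquiv fun x => ?_
    rw [← map_eq_zero_iff e e.injective, map_mul, map_add, map_natCast, Prod.ext_iff]
    rfl
  exact Nat.card_congr (e1.trans (Equiv.subtypeProdEquivProd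
    (p := fun a : ZMod m => a * (a + h) = 0) (q := fun b : ZMod n => b * (b + h) = 0)))

lemma natCard_zmod_mul_add_eq_zero {d h : ℕ} (hd : Squarefree d) (hdh : d.Coprime h) :
    Nat.card {x : ZMod d // x * (x + h) = 0} = 2 ^ ArithmeticFunction.cardFactors d := by
  induction d using induction_on_primes with
  | zero => exact absurd hd not_squarefree_zero
  | one =>
    have : {x : ZMod 1 | x * (x + h) = 0} = {0} := by
      ext x
      simp [Subsingleton.elim x 0]
    change Nat.card ({x : ZMod 1 | x * (x + h) = 0} : Set _) = _
    rw [this]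
    simp
  | prime_mul p a hp ih =>
    obtain ⟨h1, _, h2⟩ := Nat.squarefree_mul_iff.1 hd
    rw [natCard_zmod_mul_add_eq_zero_mul h1, natCard_zmod_mul_add_eq_zero_prime hp, ih h2
      (hdh.coprime_dvd_left (Dvd.intro_left _ rfl)),
      ArithmeticFunction.cardFactors_mul hp.ne_zero h2.ne_zero,
      ArithmeticFunction.cardFactors_apply_prime hp, pow_add, pow_one]
    exact hp.coprime_iff_not_dvd.1 (hdh.coprime_dvd_left (Dvd.intro _ rfl))

lemma abs_card_filter_modEq_sub_le (X d v : ℕ) (hd : 0 < d) :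
    |(((Finset.Ioc 0 X).filter (fun n => n ≡ v [MOD d])).card : ℝ) - X / d| ≤ 1 := by
  have h := Nat.Ioc_filter_modEq_card 0 X hd v
  have hd' : (0 : ℚ) < d := by exact_mod_cast hd
  set c := ((Finset.Ioc 0 X).filter (fun n => n ≡ v [MOD d])).card
  have h1 := Int.floor_le ((X - v) / (d : ℚ))
  have h2 := Int.lt_floor_add_one ((X - v) / (d : ℚ))
  have h3 := Int.floor_le (((0 : ℕ) - v) / (d : ℚ))
  have h4 := Int.lt_floor_add_one (((0 : ℕ) - v) / (d : ℚ))
  set A := ⌊(X - v) / (d : ℚ)⌋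
  set B := ⌊((0 : ℕ) - v) / (d : ℚ)⌋
  have e1 : (X - v) / (d : ℚ) = X / d - v / d := by ring
  have e2 : ((0 : ℕ) - v) / (d : ℚ) = - (v / d) := by push_cast; ring
  rw [e1] at h1 h2
  rw [e2] at h3 h4
  have hX : 0 ≤ (X : ℚ) / d := by positivity
  have h5 : ((c : ℕ) : ℚ) = max ((A : ℚ) - B) 0 := by exact_mod_cast h
  have h6 : |(c : ℚ) - X / d| ≤ 1 := by
    rw [h5, abs_le]
    constructor
    · linarith [le_max_left ((A : ℚ) - B) 0]
    · have : max ((A : ℚ) - B) 0 ≤ X / d + 1 := max_le (by linarith) (by linarith)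
      linarith
  have h7 : ((|(c : ℚ) - X / d| : ℚ) : ℝ) ≤ 1 := by exact_mod_cast h6
  push_cast at h7
  exact h7

lemma abs_card_dvd_mul_add_sub_le (X h : ℕ) {d : ℕ} (hd : Squarefree d) (hdh : d.Coprime h)
    (hd2 : Odd d) :
    |(((Finset.Ioc 0 X).filter (fun n => d ∣ n * (n + h))).card : ℝ) - oddTwoPow d * X| ≤ d := by
  have : NeZero d := ⟨hd.ne_zero⟩
  have hd0 : 0 < d := Nat.pos_of_ne_zero hd.ne_zero
  set R : Finset (ZMod d) := Finset.univ.filter (fun x => x * (x + h) = 0) with hR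
  have hRcard : R.card = 2 ^ ArithmeticFunction.cardFactors d := by
    rw [← natCard_zmod_mul_add_eq_zero hd hdh, Nat.card_eq_fintype_card, Fintype.card_subtype]
  have hmaps : ∀ n ∈ (Finset.Ioc 0 X).filter (fun n => d ∣ n * (n + h)), (n : ZMod d) ∈ R := by
    intro n hn
    rw [hR, Finset.mem_filter]
    refine ⟨Finset.mem_univ _, ?_⟩
    have := (ZMod.natCast_eq_zero_iff _ _).2 (Finset.mem_filter.1 hn).2
    exact_mod_cast this
  have hfib : ∀ x ∈ R, ((Finset.Ioc 0 X).filter (fun n => d ∣ n * (n + h))).filter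
      (fun n : ℕ => (n : ZMod d) = x) = (Finset.Ioc 0 X).filter (fun n => n ≡ x.val [MOD d]) := by
    intro x hx
    ext n
    have key : n ≡ x.val [MOD d] ↔ (n : ZMod d) = x := by
      rw [← ZMod.natCast_eq_natCast_iff, ZMod.natCast_zmod_val]
    simp only [Finset.mem_filter, key]
    constructor
    · rintro ⟨⟨h1, _⟩, h2⟩
      exact ⟨h1, h2⟩
    · rintro ⟨h1, rfl⟩
      refine ⟨⟨h1, (ZMod.natCast_eq_zero_iff _ _).1 ?_⟩, rfl⟩
      have := (Finset.mem_filter.1 hx).2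
      exact_mod_cast this
  rw [Finset.card_eq_sum_card_fiberwise (f := fun n : ℕ => (n : ZMod d)) hmaps,
    Finset.sum_congr rfl fun x hx => by rw [hfib x hx]]
  have hmain : oddTwoPow d * X = ∑ x ∈ R, (X : ℝ) / d := by
    rw [Finset.sum_const, nsmul_eq_mul, hRcard, oddTwoPow_of_odd hd2]
    push_cast
    ring
  rw [hmain]
  push_cast
  rw [← Finset.sum_sub_distrib]
  calc _ ≤ ∑ x ∈ R, (1 : ℝ) := (Finset.abs_sum_le_sum_abs _ _).trans
        (Finset.sum_le_sum fun x _ => abs_card_filter_modEq_sub_le X d x.val hd0)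
    _ = R.card := by simp
    _ ≤ d := by
        have := Finset.card_le_univ R
        rw [ZMod.card] at this
        exact_mod_cast this

/-- The odd primes up to `z` not dividing `h`. -/
def siftingPrimes (z h : ℕ) : Finset ℕ :=
  (Finset.Icc 1 z).filter (fun p => p.Prime ∧ ¬ p ∣ 2 * h)

lemma prod_siftingPrimes_squarefree (z h : ℕ) : Squarefree (∏ p ∈ siftingPrimes z h, p) := by
  refine Finset.squarefree_prod_of_pairwise_isCoprime ?_ ?_
  · intro p hp q hq hpq
    rw [Function.onFun, Nat.coprime_iff_isRelPrime.symm]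
    simp only [siftingPrimes, Finset.coe_filter, Set.mem_ofPred_eq] at hp hq
    exact (Nat.coprime_primes hp.2.1 hq.2.1).2 hpq
  · intro p hp
    exact (Finset.mem_filter.1 hp).2.1.squarefree

lemma prime_dvd_prod_siftingPrimes {z h p : ℕ} (hp : p.Prime) :
    p ∣ ∏ p ∈ siftingPrimes z h, p ↔ p ∈ siftingPrimes z h := by
  refine ⟨fun hd => ?_, fun hp => Finset.dvd_prod_of_mem _ hp⟩
  obtain ⟨q, hq, hpq⟩ := (hp.prime.dvd_finsetProd_iff _).1 hd
  have : p = q := (Nat.prime_dvd_prime_iff_eq hp (Finset.mem_filter.1 hq).2.1).1 hpq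
  rwa [this]

lemma coprime_prod_siftingPrimes (z h : ℕ) : (∏ p ∈ siftingPrimes z h, p).Coprime (2 * h) :=
  Nat.coprime_of_dvd fun _ hp hd hd' =>
    (Finset.mem_filter.1 ((prime_dvd_prod_siftingPrimes hp).1 hd)).2.2 hd'

/-- The sieve for pairs `(n, n + h)` of primes. -/
noncomputable def pairSieve (X z h : ℕ) : BoundingSieve where
  support := (Finset.Ioc 0 X).image (fun n => n * (n + h))
  prodPrimes := ∏ p ∈ siftingPrimes z h, p
  prodPrimes_squarefree := prod_siftingPrimes_squarefree z h
  weights := fun _ => 1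
  weights_nonneg := fun _ => zero_le_one
  totalMass := X
  nu := ⟨oddTwoPow, oddTwoPow_zero⟩
  nu_mult := ⟨map_one oddTwoPow, fun _ => map_mul oddTwoPow _ _⟩
  nu_pos_of_prime := fun p hp hd => by
    have h2 : p ≠ 2 := by
      rintro rfl
      exact (Finset.mem_filter.1 ((prime_dvd_prod_siftingPrimes hp).1 hd)).2.2 (Dvd.intro _ rfl)
    change 0 < oddTwoPow p
    rw [oddTwoPow_prime hp h2]
    have := hp.pos
    positivity
  nu_lt_one_of_prime := fun p hp _ => oddTwoPow_prime_lt_one hp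

lemma injective_mul_add (h : ℕ) : Function.Injective (fun n : ℕ => n * (n + h)) := by
  have : StrictMono (fun n : ℕ => n * (n + h)) := by
    intro a b hab
    change a * (a + h) < b * (b + h)
    nlinarith
  exact this.injective

lemma odd_of_dvd_prod_siftingPrimes {z h d : ℕ} (hd : d ∣ ∏ p ∈ siftingPrimes z h, p) : Odd d :=
  Nat.coprime_two_right.1 (((coprime_prod_siftingPrimes z h).coprime_dvd_left hd).coprime_dvd_right
    (Dvd.intro _ rfl))

lemma selbergSum_pairSieve_ge (X y : ℕ) {h : ℕ} (hh : 0 < h) :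
    Real.log (y + 1) ^ 2 * Real.exp (-(4 * ∑ p ∈ (2 * h).primeFactors, (p : ℝ)⁻¹)) ≤
      (pairSieve X (y ^ 2) h).selbergSum (y ^ 2) := by
  refine (log_sq_mul_exp_le_sum_oddTwoPow y hh).trans ?_
  set s := pairSieve X (y ^ 2) h with hs
  have hmaps : ∀ n ∈ (Finset.Icc 1 (y ^ 2)).filter (fun n => n.Coprime (2 * h)),
      ∏ p ∈ n.primeFactors, p ∈ s.smallDivisors (y ^ 2) := by
    intro n hn
    rw [Finset.mem_filter, Finset.mem_Icc] at hn
    rw [BoundingSieve.smallDivisors, Finset.mem_filter, Nat.mem_divisors]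
    refine ⟨⟨?_, BoundingSieve.prodPrimes_ne_zero⟩,
      (Nat.le_of_dvd hn.1.1 (Nat.prod_primeFactors_dvd n)).trans hn.1.2⟩
    change _ ∣ ∏ p ∈ siftingPrimes (y ^ 2) h, p
    refine Finset.prod_dvd_prod_of_subset _ _ _ fun p hp => ?_
    obtain ⟨hp1, hp2, _⟩ := Nat.mem_primeFactors.1 hp
    refine Finset.mem_filter.2 ⟨Finset.mem_Icc.2 ⟨hp1.pos,
      (Nat.le_of_dvd hn.1.1 hp2).trans hn.1.2⟩, hp1, fun hd => ?_⟩
    exact Nat.not_coprime_of_dvd_of_dvd hp1.one_lt hp2 hd hn.2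
  rw [← Finset.sum_fiberwise_of_maps_to hmaps, BoundingSieve.selbergSum]
  refine Finset.sum_le_sum fun l _ => ?_
  rw [BoundingSieve.selbergTerms_apply]
  refine sum_oddTwoPow_radical_le _ fun n hn => ?_
  rw [Finset.mem_filter, Finset.mem_filter, Finset.mem_Icc] at hn
  exact ⟨by omega, hn.2⟩

lemma card_prime_pairs_le_sieve (X y : ℕ) {h : ℕ} (hh : 0 < h) (hy : 1 ≤ y) :
    (((Finset.Icc 1 X).filter (fun p => p.Prime ∧ (p + h).Prime)).card : ℝ) ≤
      X / Real.log (y + 1) ^ 2 * Real.exp (4 * ∑ p ∈ (2 * h).primeFactors, (p : ℝ)⁻¹) +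
        2 * (y : ℝ) ^ 12 := by
  set s := pairSieve X (y ^ 2) h with hs
  have hsub : ((Finset.Icc 1 X).filter (fun p => p.Prime ∧ (p + h).Prime)) ⊆
      Finset.Icc 1 (y ^ 2) ∪ (Finset.Ioc 0 X).filter
        (fun n => Nat.Coprime s.prodPrimes (n * (n + h))) := by
    intro p hp
    obtain ⟨h1, h2, h3⟩ := Finset.mem_filter.1 hp
    rw [Finset.mem_Icc] at h1
    rw [Finset.mem_union, Finset.mem_Icc, Finset.mem_filter, Finset.mem_Ioc]
    by_cases hpy : p ≤ y ^ 2
    · exact Or.inl ⟨h1.1, hpy⟩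
    · refine Or.inr ⟨h1, Nat.coprime_of_dvd fun q hq hd hd' => ?_⟩
      have hq2 := (Finset.mem_Icc.1 (Finset.mem_filter.1
        ((prime_dvd_prod_siftingPrimes hq).1 hd)).1).2
      rcases hq.dvd_mul.1 hd' with hd' | hd'
      · have := (Nat.prime_dvd_prime_iff_eq hq h2).1 hd'
        omega
      · have := (Nat.prime_dvd_prime_iff_eq hq h3).1 hd'
        omega
  have hsift : s.siftedSum = (((Finset.Ioc 0 X).filter
        (fun n => Nat.Coprime s.prodPrimes (n * (n + h)))).card : ℝ) := by
    rw [BoundingSieve.siftedSum]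
    change ∑ d ∈ (Finset.Ioc 0 X).image (fun n => n * (n + h)), _ = _
    rw [Finset.sum_image (fun a _ b _ hab => injective_mul_add h hab), ← Finset.sum_filter]
    simp [hs, pairSieve]
  have hsieve : s.siftedSum ≤ s.totalMass / s.selbergSum (y ^ 2) + ((y ^ 2 : ℕ) : ℝ) ^ 6 := by
    refine BoundingSieve.siftedSum_le_of_rem_le (Nat.one_le_pow _ _ hy) (fun d hd => ?_)
      fun d hd => ?_
    · have hodd := odd_of_dvd_prod_siftingPrimes hd
      change (oddTwoPow d)⁻¹ ≤ d
      rw [oddTwoPow_of_odd hodd, inv_div]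
      exact div_le_self (by positivity) (one_le_pow₀ (by norm_num))
    · have hodd := odd_of_dvd_prod_siftingPrimes hd
      have hcop := ((coprime_prod_siftingPrimes (y ^ 2) h).coprime_dvd_left hd).coprime_dvd_right
        (Dvd.intro_left 2 rfl)
      have := abs_card_dvd_mul_add_sub_le X h (BoundingSieve.squarefree_of_dvd_prodPrimes hd)
        hcop hodd
      rw [BoundingSieve.rem]
      have hm : s.multSum d = ((Finset.Ioc 0 X).filter (fun n => d ∣ n * (n + h))).card := by
        rw [BoundingSieve.multSum]
        change ∑ n ∈ (Finset.Ioc 0 X).image (fun n => n * (n + h)), _ = _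
        rw [Finset.sum_image (fun a _ b _ hab => injective_mul_add h hab), ← Finset.sum_filter]
        simp [hs, pairSieve]
      rw [hm]
      exact this
  have hlog : 0 < Real.log (y + 1) := Real.log_pos (by
    have : (1 : ℝ) ≤ y := by exact_mod_cast hy
    linarith)
  have hV := selbergSum_pairSieve_ge X y hh
  have hmain : s.totalMass / s.selbergSum (y ^ 2) ≤
      X / Real.log (y + 1) ^ 2 * Real.exp (4 * ∑ p ∈ (2 * h).primeFactors, (p : ℝ)⁻¹) := by
    calc _ ≤ (X : ℝ) / (Real.log (y + 1) ^ 2 *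
          Real.exp (-(4 * ∑ p ∈ (2 * h).primeFactors, (p : ℝ)⁻¹))) := by
          refine div_le_div_of_nonneg_left (Nat.cast_nonneg _) ?_ hV
          positivity
      _ = _ := by
          rw [Real.exp_neg]
          field_simp
  have hcard := (Finset.card_le_card hsub).trans (Finset.card_union_le _ _)
  rw [Nat.card_Icc] at hcard
  have hcard' : (((Finset.Icc 1 X).filter (fun p => p.Prime ∧ (p + h).Prime)).card : ℝ) ≤
      (y : ℝ) ^ 2 + s.siftedSum := by
    rw [hsift]
    exact_mod_cast hcard
  have hy' : (1 : ℝ) ≤ y := by exact_mod_cast hy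
  have h12 : (y : ℝ) ^ 2 ≤ (y : ℝ) ^ 12 := pow_le_pow_right₀ hy' (by norm_num)
  have h26 : ((y ^ 2 : ℕ) : ℝ) ^ 6 = (y : ℝ) ^ 12 := by push_cast; ring
  rw [h26] at hsieve
  linarith

/-- An upper bound for the number of pairs of primes with a given difference. -/
theorem exists_card_prime_pairs_le : ∃ C > (0 : ℝ), ∀ X h : ℕ, 2 ≤ X → 0 < h →
    (((Finset.Icc 1 X).filter (fun p => p.Prime ∧ (p + h).Prime)).card : ℝ) ≤
      C * (X / Real.log X ^ 2) * Real.exp (4 * ∑ p ∈ h.primeFactors, (p : ℝ)⁻¹) := by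
  refine ⟨576 * Real.exp 2 + 32, by positivity, fun X h hX hh => ?_⟩
  have hX' : (2 : ℝ) ≤ X := by exact_mod_cast hX
  have hX0 : (0 : ℝ) < X := by linarith
  have hlog : 0 < Real.log X := Real.log_pos (by linarith)
  set y := ⌊(X : ℝ) ^ (1 / 24 : ℝ)⌋₊ with hy
  have hy1 : 1 ≤ y := Nat.le_floor (by
    rw [Nat.cast_one]; exact Real.one_le_rpow (by linarith) (by norm_num))
  have hle : (y : ℝ) ≤ (X : ℝ) ^ (1 / 24 : ℝ) := Nat.floor_le (by positivity)
  have hlt : (X : ℝ) ^ (1 / 24 : ℝ) < y + 1 := Nat.lt_floor_add_one _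
  refine (card_prime_pairs_le_sieve X y hh hy1).trans ?_
  have h1 : Real.log X / 24 ≤ Real.log (y + 1) := by
    have := Real.log_le_log (by positivity) hlt.le
    rw [Real.log_rpow hX0] at this
    linarith
  have h2 : (y : ℝ) ^ 12 ≤ 16 * (X / Real.log X ^ 2) := by
    have e1 : (y : ℝ) ^ 12 ≤ (X : ℝ) ^ (1 / 2 : ℝ) := by
      calc (y : ℝ) ^ 12 ≤ ((X : ℝ) ^ (1 / 24 : ℝ)) ^ 12 := by gcongr
        _ = _ := by
          rw [← Real.rpow_natCast, ← Real.rpow_mul hX0.le]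
          norm_num
    have e2 : Real.log X ≤ 4 * (X : ℝ) ^ (1 / 4 : ℝ) := by
      have := Real.log_le_rpow_div hX0.le (show (0 : ℝ) < 1 / 4 by norm_num)
      linarith
    have e3 : Real.log X ^ 2 ≤ 16 * (X : ℝ) ^ (1 / 2 : ℝ) := by
      calc Real.log X ^ 2 ≤ (4 * (X : ℝ) ^ (1 / 4 : ℝ)) ^ 2 := by gcongr
        _ = _ := by
          rw [mul_pow, ← Real.rpow_natCast ((X : ℝ) ^ (1 / 4 : ℝ)), ← Real.rpow_mul hX0.le]
          norm_num
    have e4 : (X : ℝ) ^ (1 / 2 : ℝ) * (X : ℝ) ^ (1 / 2 : ℝ) = X := by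
      rw [← Real.rpow_add hX0]
      norm_num
    rw [← mul_div_assoc, le_div_iff₀ (by positivity)]
    calc (y : ℝ) ^ 12 * Real.log X ^ 2 ≤
        (X : ℝ) ^ (1 / 2 : ℝ) * (16 * (X : ℝ) ^ (1 / 2 : ℝ)) := by gcongr
      _ = _ := by rw [mul_left_comm, e4]
  have h3 : Real.exp (4 * ∑ p ∈ (2 * h).primeFactors, (p : ℝ)⁻¹) ≤
      Real.exp 2 * Real.exp (4 * ∑ p ∈ h.primeFactors, (p : ℝ)⁻¹) := by
    rw [← Real.exp_add]
    refine Real.exp_le_exp.2 ?_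
    rw [Nat.primeFactors_mul (by norm_num) hh.ne', Nat.prime_two.primeFactors]
    have : ∑ p ∈ {2} ∪ h.primeFactors, (p : ℝ)⁻¹ ≤
        ∑ p ∈ ({2} : Finset ℕ), (p : ℝ)⁻¹ + ∑ p ∈ h.primeFactors, (p : ℝ)⁻¹ := by
      rw [← Finset.sum_union_inter]
      exact le_add_of_nonneg_right (Finset.sum_nonneg fun _ _ => by positivity)
    rw [Finset.sum_singleton] at this
    push_cast at this
    linarith
  have h4 : 1 ≤ Real.exp (4 * ∑ p ∈ h.primeFactors, (p : ℝ)⁻¹) :=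
    Real.one_le_exp (mul_nonneg (by norm_num) (Finset.sum_nonneg fun _ _ => by positivity))
  have h5 : X / Real.log (y + 1) ^ 2 ≤ 576 * (X / Real.log X ^ 2) := by
    calc X / Real.log (y + 1) ^ 2 ≤ X / (Real.log X / 24) ^ 2 := by gcongr
      _ = _ := by field_simp; norm_num
  have h6 : 0 ≤ X / Real.log X ^ 2 := by positivity
  calc _ ≤ 576 * (X / Real.log X ^ 2) *
        (Real.exp 2 * Real.exp (4 * ∑ p ∈ h.primeFactors, (p : ℝ)⁻¹)) +
        2 * (16 * (X / Real.log X ^ 2)) * Real.exp (4 * ∑ p ∈ h.primeFactors, (p : ℝ)⁻¹) := by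
        refine add_le_add (by gcongr) ?_
        calc 2 * (y : ℝ) ^ 12 ≤ 2 * (16 * (X / Real.log X ^ 2)) * 1 := by linarith
          _ ≤ _ := by gcongr
    _ = _ := by ring

lemma card_primeFactors_le_log {n : ℕ} (hn : n ≠ 0) : n.primeFactors.card ≤ Nat.log 2 n := by
  refine Nat.le_log_of_pow_le (by norm_num) ?_
  calc 2 ^ n.primeFactors.card ≤ ∏ p ∈ n.primeFactors, p :=
        Finset.pow_card_le_prod _ _ _ fun p hp => (Nat.prime_of_mem_primeFactors hp).two_le
    _ ≤ n := Nat.le_of_dvd (Nat.pos_of_ne_zero hn) (Nat.prod_primeFactors_dvd n)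

lemma card_primes_dyadic_mul_log_le (j : ℕ) (T : Finset ℕ)
    (hT : ∀ p ∈ T, p.Prime ∧ 2 ^ j ≤ p ∧ p < 2 ^ (j + 1)) :
    (T.card : ℝ) * (j * Real.log 2) ≤ Real.log 4 * 2 ^ (j + 1) := by
  have h := Chebyshev.theta_le_log4_mul_x (x := 2 ^ (j + 1)) (by positivity)
  refine le_trans ?_ h
  rw [Chebyshev.theta, ← nsmul_eq_mul, ← Finset.sum_const]
  calc ∑ p ∈ T, (j * Real.log 2) ≤ ∑ p ∈ T, Real.log p := by
        refine Finset.sum_le_sum fun p hp => ?_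
        rw [← Real.log_pow]
        exact Real.log_le_log (by positivity) (by exact_mod_cast (hT p hp).2.1)
    _ ≤ _ := by
        refine Finset.sum_le_sum_of_subset_of_nonneg (fun p hp => ?_)
          fun p _ _ => Real.log_natCast_nonneg p
        rw [Finset.mem_filter, Finset.mem_Ioc]
        refine ⟨⟨(hT p hp).1.pos, Nat.le_floor ?_⟩, (hT p hp).1⟩
        exact_mod_cast (hT p hp).2.2.le

/-- The sum of `1 / (p log p)` over primes converges. -/
lemma summable_prime_inv_mul_log :
    Summable (fun p : ℕ => if p.Prime then ((p : ℝ) * Real.log p)⁻¹ else 0) := by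
  have hnn : ∀ p : ℕ, 0 ≤ (if p.Prime then ((p : ℝ) * Real.log p)⁻¹ else 0) := by
    intro p
    split_ifs
    · exact inv_nonneg.2 (mul_nonneg (Nat.cast_nonneg _) (Real.log_natCast_nonneg p))
    · rfl
  have hl2 : 0 < Real.log 2 := Real.log_pos (by norm_num)
  have hs : Summable (fun j : ℕ => 4 / Real.log 2 * (1 / (j : ℝ) ^ 2)) :=
    (Real.summable_one_div_nat_pow.2 (by norm_num)).mul_left _
  refine summable_of_sum_le (c := ∑' j : ℕ, 4 / Real.log 2 * (1 / (j : ℝ) ^ 2)) hnn fun T => ?_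
  rw [← Finset.sum_filter]
  rw [← Finset.sum_fiberwise_of_maps_to (t := T.image (Nat.log 2)) (g := Nat.log 2)
    (fun p hp => Finset.mem_image_of_mem _ (Finset.mem_filter.1 hp).1)]
  refine le_trans (Finset.sum_le_sum fun j _ => ?_)
    (hs.sum_le_tsum (T.image (Nat.log 2)) fun j _ => by positivity)
  set U := (T.filter Nat.Prime).filter (fun p => Nat.log 2 p = j) with hU
  have hUp : ∀ p ∈ U, p.Prime ∧ 2 ^ j ≤ p ∧ p < 2 ^ (j + 1) := by
    intro p hp
    obtain ⟨hp1, hp2⟩ := Finset.mem_filter.1 hp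
    have hpp := (Finset.mem_filter.1 hp1).2
    subst hp2
    exact ⟨hpp, Nat.pow_log_le_self 2 hpp.ne_zero, Nat.lt_pow_succ_log_self (by norm_num) p⟩
  rcases Nat.eq_zero_or_pos j with rfl | hj
  · have : U = ∅ := by
      refine Finset.eq_empty_of_forall_notMem fun p hp => ?_
      have := hUp p hp
      have := this.1.two_le
      omega
    rw [this]
    simp
  have hj' : (0 : ℝ) < j := by exact_mod_cast hj
  have hcard := card_primes_dyadic_mul_log_le j U hUp
  have h4 : Real.log 4 = 2 * Real.log 2 := by
    rw [show (4 : ℝ) = 2 ^ 2 by norm_num, Real.log_pow]; norm_num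
  calc ∑ p ∈ U, ((p : ℝ) * Real.log p)⁻¹ ≤ ∑ p ∈ U, ((2 : ℝ) ^ j * (j * Real.log 2))⁻¹ := by
        refine Finset.sum_le_sum fun p hp => inv_anti₀ (by positivity) ?_
        have h1 : (2 : ℝ) ^ j ≤ p := by exact_mod_cast (hUp p hp).2.1
        have h2 : j * Real.log 2 ≤ Real.log p := by
          rw [← Real.log_pow]
          exact Real.log_le_log (by positivity) h1
        gcongr
    _ = (U.card * (j * Real.log 2)) / ((2 : ℝ) ^ j * (j * Real.log 2) ^ 2) := by
        rw [Finset.sum_const, nsmul_eq_mul]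
        field_simp
    _ ≤ (Real.log 4 * 2 ^ (j + 1)) / ((2 : ℝ) ^ j * (j * Real.log 2) ^ 2) := by gcongr
    _ = _ := by
        rw [h4, pow_succ]
        field_simp
        norm_num

/-- A convexity bound for `exp (4 ∑ 1 / p)` over the prime factors of an integer. -/
lemma exists_exp_sum_inv_primeFactors_le {η : ℝ} (hη : 0 < η) : ∃ C > (0 : ℝ), ∀ n ℓ : ℕ,
    n.primeFactors.card ≤ ℓ → Real.exp (4 * ∑ p ∈ n.primeFactors, (p : ℝ)⁻¹) ≤
      C * (1 + ∑ p ∈ n.primeFactors.filter (fun p => p ≠ 2 ∧ p ≤ ℓ), (p : ℝ) ^ (η - 1)) := by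
  obtain ⟨s, hs⟩ := summable_iff_vanishing_norm.1 summable_prime_inv_mul_log (η / 4)
    (by positivity)
  set c : ℝ := ∑ p ∈ insert 2 s, (p : ℝ)⁻¹ with hc
  refine ⟨Real.exp (4 * (1 + c)) * (1 + 4 / η), by positivity, fun n ℓ hn => ?_⟩
  set D := (n.primeFactors.filter (fun p => p ≠ 2 ∧ p ≤ ℓ)).filter (fun p => p ∉ s) with hD
  have hsub : n.primeFactors ⊆ (n.primeFactors.filter (fun p => ℓ < p) ∪ insert 2 s) ∪ D := by
    intro p hp
    simp only [hD, Finset.mem_union, Finset.mem_filter, Finset.mem_insert, hp, true_and]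
    rcases lt_or_ge ℓ p with h | h
    · tauto
    · tauto
  have hun : ∀ A B : Finset ℕ, ∑ p ∈ A ∪ B, (p : ℝ)⁻¹ ≤ ∑ p ∈ A, (p : ℝ)⁻¹ + ∑ p ∈ B, (p : ℝ)⁻¹ := by
    intro A B
    rw [← Finset.sum_union_inter]
    exact le_add_of_nonneg_right (Finset.sum_nonneg fun _ _ => by positivity)
  have hbig : ∑ p ∈ n.primeFactors.filter (fun p => ℓ < p), (p : ℝ)⁻¹ ≤ 1 := by
    calc _ ≤ ∑ p ∈ n.primeFactors.filter (fun p => ℓ < p), ((ℓ : ℝ) + 1)⁻¹ := by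
          refine Finset.sum_le_sum fun p hp => inv_anti₀ (by positivity) ?_
          exact_mod_cast (Finset.mem_filter.1 hp).2
      _ = ((n.primeFactors.filter (fun p => ℓ < p)).card : ℝ) / (ℓ + 1) := by
          rw [Finset.sum_const, nsmul_eq_mul, div_eq_mul_inv]
      _ ≤ 1 := by
          rw [div_le_one (by positivity)]
          have := (Finset.card_filter_le n.primeFactors (fun p => ℓ < p)).trans hn
          exact_mod_cast this.trans (Nat.le_succ _)
  have hsum : ∑ p ∈ n.primeFactors, (p : ℝ)⁻¹ ≤ 1 + c + ∑ p ∈ D, (p : ℝ)⁻¹ := by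
    refine (Finset.sum_le_sum_of_subset_of_nonneg hsub fun _ _ _ => by positivity).trans ?_
    linarith [hun (n.primeFactors.filter (fun p => ℓ < p) ∪ insert 2 s) D,
      hun (n.primeFactors.filter (fun p => ℓ < p)) (insert 2 s)]
  have hDp : ∀ p ∈ D, p.Prime ∧ 3 ≤ p := by
    intro p hp
    obtain ⟨h1, h2, _⟩ := Finset.mem_filter.1 (Finset.mem_filter.1 hp).1
    have hpp := Nat.prime_of_mem_primeFactors h1
    exact ⟨hpp, by have := hpp.two_le; omega⟩
  have hlogp : ∀ p ∈ D, 1 ≤ Real.log p := by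
    intro p hp
    rw [Real.le_log_iff_exp_le (by exact_mod_cast (hDp p hp).1.pos)]
    have h3 : (3 : ℝ) ≤ p := by exact_mod_cast (hDp p hp).2
    linarith [Real.exp_one_lt_three]
  have hDsum : ∑ p ∈ D, ((p : ℝ) * Real.log p)⁻¹ ≤ η / 4 := by
    have hdis : Disjoint D s := Finset.disjoint_left.2 fun p hp => (Finset.mem_filter.1 hp).2
    have := hs D hdis
    rw [Finset.sum_congr rfl fun p hp => if_pos (hDp p hp).1] at this
    exact (le_abs_self _).trans this.le
  have hjensen : Real.exp (4 * ∑ p ∈ D, (p : ℝ)⁻¹) ≤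
      1 + ∑ p ∈ D, 4 / η * ((p : ℝ) * Real.log p)⁻¹ * (p : ℝ) ^ η := by
    set v : ℝ := 1 - ∑ p ∈ D, 4 / η * ((p : ℝ) * Real.log p)⁻¹ with hv
    have hv0 : 0 ≤ v := by
      rw [hv, ← Finset.mul_sum]
      have : 4 / η * ∑ p ∈ D, ((p : ℝ) * Real.log p)⁻¹ ≤ 4 / η * (η / 4) := by gcongr
      have h1 : 4 / η * (η / 4) = 1 := by field_simp
      linarith
    have hw : ∀ p ∈ D, 0 ≤ 4 / η * ((p : ℝ) * Real.log p)⁻¹ := by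
      intro p hp
      have := hlogp p hp
      positivity
    have h := convexOn_exp.map_add_sum_le (t := D) (v := v) (q := 0)
      (w := fun p : ℕ => 4 / η * ((p : ℝ) * Real.log p)⁻¹) (p := fun p : ℕ => η * Real.log p)
      hw (by rw [hv]; ring) (fun _ _ => Set.mem_univ _) hv0 (Set.mem_univ _)
    simp only [smul_eq_mul, mul_zero, zero_add, Real.exp_zero, mul_one] at h
    have e1 : ∑ p ∈ D, 4 / η * ((p : ℝ) * Real.log p)⁻¹ * (η * Real.log p) =
        4 * ∑ p ∈ D, (p : ℝ)⁻¹ := by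
      rw [Finset.mul_sum]
      refine Finset.sum_congr rfl fun p hp => ?_
      have h1 := hlogp p hp
      have h2 : (0 : ℝ) < p := by exact_mod_cast (hDp p hp).1.pos
      field_simp
    rw [e1] at h
    refine h.trans ?_
    have e2 : v ≤ 1 := by
      rw [hv]
      linarith [Finset.sum_nonneg hw]
    refine add_le_add e2 (le_of_eq (Finset.sum_congr rfl fun p hp => ?_))
    have h2 : (0 : ℝ) < p := by exact_mod_cast (hDp p hp).1.pos
    rw [Real.rpow_def_of_pos h2, mul_comm η]
  have hterm : ∑ p ∈ D, 4 / η * ((p : ℝ) * Real.log p)⁻¹ * (p : ℝ) ^ η ≤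
      4 / η * ∑ p ∈ n.primeFactors.filter (fun p => p ≠ 2 ∧ p ≤ ℓ), (p : ℝ) ^ (η - 1) := by
    calc _ ≤ ∑ p ∈ D, 4 / η * (p : ℝ) ^ (η - 1) := by
          refine Finset.sum_le_sum fun p hp => ?_
          have h1 := hlogp p hp
          have h2 : (0 : ℝ) < p := by exact_mod_cast (hDp p hp).1.pos
          rw [Real.rpow_sub_one h2.ne', mul_assoc]
          refine mul_le_mul_of_nonneg_left ?_ (by positivity)
          rw [div_eq_inv_mul]
          refine mul_le_mul_of_nonneg_right (inv_anti₀ h2 ?_) (by positivity)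
          nlinarith
      _ ≤ _ := by
          rw [← Finset.mul_sum]
          refine mul_le_mul_of_nonneg_left (Finset.sum_le_sum_of_subset_of_nonneg
            (Finset.filter_subset _ _) fun _ _ _ => by positivity) (by positivity)
  set Q := ∑ p ∈ n.primeFactors.filter (fun p => p ≠ 2 ∧ p ≤ ℓ), (p : ℝ) ^ (η - 1) with hQ
  have hQ0 : 0 ≤ Q := Finset.sum_nonneg fun _ _ => by positivity
  calc _ ≤ Real.exp (4 * (1 + c)) * Real.exp (4 * ∑ p ∈ D, (p : ℝ)⁻¹) := by
        rw [← Real.exp_add]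
        exact Real.exp_le_exp.2 (by linarith)
    _ ≤ Real.exp (4 * (1 + c)) * ((1 + 4 / η) * (1 + Q)) := by
        gcongr
        have : 0 ≤ 4 / η := by positivity
        nlinarith
    _ = _ := by ring

lemma orderOf_two_pos {p : ℕ} (hp : p.Prime) (hp2 : p ≠ 2) : 0 < orderOf (2 : ZMod p) := by
  have := Fact.mk hp
  have h2 : (2 : ZMod p) ≠ 0 := by
    intro h
    have : p ∣ 2 := (ZMod.natCast_eq_zero_iff 2 p).1 (by exact_mod_cast h)
    exact hp2 ((Nat.prime_dvd_prime_iff_eq hp Nat.prime_two).1 this)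
  exact orderOf_pos_iff.2 (isOfFinOrder_iff_pow_eq_one.2
    ⟨p - 1, Nat.sub_pos_of_lt hp.one_lt, ZMod.pow_card_sub_one_eq_one h2⟩)

/-- A variant of Romanoff's theorem on the orders of `2` modulo primes. -/
lemma exists_sum_orderOf_two_le {δ : ℝ} (hδ : 0 < δ) : ∃ η > (0 : ℝ), ∃ C > (0 : ℝ),
    ∀ T : Finset ℕ, (∀ p ∈ T, p.Prime ∧ p ≠ 2) →
      ∑ p ∈ T, (p : ℝ) ^ (η - 1) *
        (if orderOf (2 : ZMod p) ^ 3 < p then 1 else (p : ℝ) ^ (-δ)) ≤ C := by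
  have hs1 : Summable (fun n : ℕ => (n : ℝ) ^ (-(1 + δ / 2))) :=
    Real.summable_nat_rpow.2 (by linarith)
  have hs2 : Summable (fun n : ℕ => (n : ℝ) ^ (-(5 / 4) : ℝ)) :=
    Real.summable_nat_rpow.2 (by norm_num)
  have hp1 : 0 ≤ ∑' n : ℕ, (n : ℝ) ^ (-(1 + δ / 2)) := tsum_nonneg fun _ => by positivity
  have hp2 : 0 ≤ ∑' n : ℕ, (n : ℝ) ^ (-(5 / 4) : ℝ) := tsum_nonneg fun _ => by positivity
  refine ⟨min (δ / 2) (1 / 4), lt_min (by linarith) (by norm_num),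
    ∑' n : ℕ, (n : ℝ) ^ (-(5 / 4) : ℝ) + ∑' n : ℕ, (n : ℝ) ^ (-(1 + δ / 2)) + 1, by linarith,
    fun T hT => ?_⟩
  set η := min (δ / 2) (1 / 4) with hη
  have hη1 : η ≤ δ / 2 := min_le_left _ _
  have hη2 : η ≤ 1 / 4 := min_le_right _ _
  rw [← Finset.sum_filter_add_sum_filter_not T (fun p => orderOf (2 : ZMod p) ^ 3 < p)]
  have hgood : ∑ p ∈ T.filter (fun p => ¬ orderOf (2 : ZMod p) ^ 3 < p), (p : ℝ) ^ (η - 1) *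
      (if orderOf (2 : ZMod p) ^ 3 < p then 1 else (p : ℝ) ^ (-δ)) ≤
      ∑' n : ℕ, (n : ℝ) ^ (-(1 + δ / 2)) := by
    refine le_trans (Finset.sum_le_sum fun p hp => ?_)
      (hs1.sum_le_tsum (T.filter (fun p => ¬ orderOf (2 : ZMod p) ^ 3 < p))
        fun _ _ => by positivity)
    obtain ⟨h1, h2⟩ := Finset.mem_filter.1 hp
    have h3 : (1 : ℝ) ≤ p := by exact_mod_cast (hT p h1).1.one_le
    rw [if_neg h2, ← Real.rpow_add (by linarith)]
    exact Real.rpow_le_rpow_of_exponent_le h3 (by linarith)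
  have hbad : ∑ p ∈ T.filter (fun p => orderOf (2 : ZMod p) ^ 3 < p), (p : ℝ) ^ (η - 1) *
      (if orderOf (2 : ZMod p) ^ 3 < p then 1 else (p : ℝ) ^ (-δ)) ≤
      ∑' n : ℕ, (n : ℝ) ^ (-(5 / 4) : ℝ) := by
    rw [← Finset.sum_fiberwise_of_maps_to (t := T.image (fun p => orderOf (2 : ZMod p)))
      (g := fun p : ℕ => orderOf (2 : ZMod p))
      (fun p hp => Finset.mem_image_of_mem _ (Finset.mem_filter.1 hp).1)]
    refine le_trans (Finset.sum_le_sum fun e he => ?_)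
      (hs2.sum_le_tsum (T.image (fun p => orderOf (2 : ZMod p))) fun _ _ => by positivity)
    obtain ⟨q, hq, rfl⟩ := Finset.mem_image.1 he
    have he0 : 0 < orderOf (2 : ZMod q) := orderOf_two_pos (hT q hq).1 (hT q hq).2
    set e := orderOf (2 : ZMod q)
    set U := (T.filter (fun p => orderOf (2 : ZMod p) ^ 3 < p)).filter
      (fun p : ℕ => orderOf (2 : ZMod p) = e) with hU
    have he1 : (1 : ℝ) ≤ e := by exact_mod_cast he0
    have hcard : (U.card : ℝ) ≤ e := by
      have h2e : 2 ≤ 2 ^ e := by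
        calc 2 = 2 ^ 1 := rfl
          _ ≤ 2 ^ e := Nat.pow_le_pow_right (by norm_num) he0
      have hsub : U ⊆ (2 ^ e - 1).primeFactors := by
        intro p hp
        obtain ⟨h1, h2⟩ := Finset.mem_filter.1 hp
        have hpT := hT p (Finset.mem_filter.1 h1).1
        refine Nat.mem_primeFactors.2 ⟨hpT.1, ?_, by omega⟩
        rw [← ZMod.natCast_eq_zero_iff, Nat.cast_sub (by omega)]
        push_cast
        rw [← h2, pow_orderOf_eq_one, sub_self]
      have h1 := (Finset.card_le_card hsub).trans
        (card_primeFactors_le_log (n := 2 ^ e - 1) (by omega))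
      have h2 : Nat.log 2 (2 ^ e - 1) ≤ Nat.log 2 (2 ^ e) := Nat.log_mono_right (Nat.sub_le _ _)
      rw [Nat.log_pow (by norm_num)] at h2
      exact_mod_cast h1.trans h2
    calc _ ≤ ∑ p ∈ U, (e : ℝ) ^ (-(9 / 4) : ℝ) := by
          refine Finset.sum_le_sum fun p hp => ?_
          obtain ⟨h1, h2⟩ := Finset.mem_filter.1 hp
          obtain ⟨h3, h4⟩ := Finset.mem_filter.1 h1
          rw [if_pos h4, mul_one]
          rw [h2] at h4
          have h5 : ((e : ℝ) ^ 3) ≤ p := by exact_mod_cast h4.le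
          calc (p : ℝ) ^ (η - 1) ≤ ((e : ℝ) ^ 3) ^ (η - 1) :=
                Real.rpow_le_rpow_of_nonpos (by positivity) h5 (by linarith)
            _ = (e : ℝ) ^ (3 * (η - 1)) := by
                rw [← Real.rpow_natCast, ← Real.rpow_mul (by positivity)]
                norm_num
            _ ≤ _ := Real.rpow_le_rpow_of_exponent_le he1 (by linarith)
      _ = U.card * (e : ℝ) ^ (-(9 / 4) : ℝ) := by rw [Finset.sum_const, nsmul_eq_mul]
      _ ≤ e * (e : ℝ) ^ (-(9 / 4) : ℝ) := by gcongr
      _ = (e : ℝ) ^ (-(5 / 4) : ℝ) := by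
          rw [← Real.rpow_one_add' (by positivity) (by norm_num)]
          norm_num
  linarith

/-- Chebyshev's upper bound for the number of primes, in a range where it is uniform. -/
lemma card_primes_Icc_le {X : ℕ} (hX : 2 ≤ X) :
    (((Finset.Icc 1 X).filter Nat.Prime).card : ℝ) ≤
      (2 * Real.log 4 + 2) * (X / Real.log X) := by
  have hX' : (2 : ℝ) ≤ X := by exact_mod_cast hX
  have hlog : 0 < Real.log X := Real.log_pos (by linarith)
  have h1 : ((Finset.Icc 1 X).filter Nat.Prime).card ≤ X.primeCounting := by
    rw [Nat.primeCounting, ← Nat.primesBelow_card_eq_primeCounting']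
    refine Finset.card_le_card fun p hp => ?_
    simp only [Finset.mem_filter, Finset.mem_Icc] at hp
    exact Nat.mem_primesBelow.mpr ⟨by omega, hp.2⟩
  have h2 := Chebyshev.pi_le_log4_mul_div (x := (X : ℝ)) (by linarith)
  rw [Nat.floor_natCast] at h2
  have h3 : Real.log √(X : ℝ) = Real.log X / 2 := Real.log_sqrt (by linarith)
  have hs : 0 < √(X : ℝ) := Real.sqrt_pos.mpr (by linarith)
  have h4 : √(X : ℝ) ≤ 2 * (X / Real.log X) := by
    have h5 : Real.log √(X : ℝ) ≤ √(X : ℝ) := (Real.log_le_sub_one_of_pos hs).trans (by linarith)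
    rw [← mul_div_assoc, le_div_iff₀ hlog]
    nlinarith [Real.mul_self_sqrt (show (0 : ℝ) ≤ X by linarith)]
  calc _ ≤ (X.primeCounting : ℝ) := by exact_mod_cast h1
    _ ≤ _ := h2
    _ ≤ 2 * Real.log 4 * (X / Real.log X) + 2 * (X / Real.log X) := by
      gcongr
      rw [h3]
      apply le_of_eq
      field_simp
    _ = _ := by ring

/-- The representations `p + a = p' + a'` are controlled by pairs of primes with difference
`|a - a'|`. -/
lemma card_rep_pairs_le (X : ℕ) (A : Finset ℕ) :
    (((Finset.Icc 1 X).filter Nat.Prime ×ˢ A ×ˢ (Finset.Icc 1 X).filter Nat.Prime ×ˢ A).filter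
      (fun q : ℕ × ℕ × ℕ × ℕ => q.1 + q.2.1 = q.2.2.1 + q.2.2.2)).card ≤
    ∑ b ∈ A ×ˢ A, ((Finset.Icc 1 X).filter
      (fun p => p.Prime ∧ (p + ((b.1 - b.2) + (b.2 - b.1))).Prime)).card := by
  rw [Finset.card_eq_sum_card_fiberwise (f := fun q : ℕ × ℕ × ℕ × ℕ => (q.2.1, q.2.2.2))
    (t := A ×ˢ A)]
  · refine Finset.sum_le_sum fun b _ => ?_
    refine Finset.card_le_card_of_injOn (fun q => min q.1 q.2.2.1) ?_ ?_
    · rintro ⟨p, a, p', a'⟩ hq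
      simp only [Finset.coe_filter, Finset.mem_filter, Finset.mem_product, Finset.mem_Icc,
        Set.mem_ofPred_eq] at hq ⊢
      obtain ⟨⟨⟨⟨hp1, hp⟩, -, ⟨hp1', hp'⟩, -⟩, he⟩, rfl⟩ := hq
      dsimp only
      rcases le_total p p' with h | h
      · rw [min_eq_left h, show p + ((a - a') + (a' - a)) = p' by omega]
        exact ⟨hp1, hp, hp'⟩
      · rw [min_eq_right h, show p' + ((a - a') + (a' - a)) = p by omega]
        exact ⟨hp1', hp', hp⟩
    · rintro ⟨p, a, p', a'⟩ hq ⟨u, c, u', c'⟩ hu h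
      simp only [Finset.coe_filter, Finset.mem_filter, Finset.mem_product, Finset.mem_Icc,
        Set.mem_ofPred_eq] at hq hu h
      obtain ⟨⟨-, he⟩, rfl⟩ := hq
      obtain ⟨⟨-, he'⟩, hb⟩ := hu
      simp only [Prod.mk.injEq] at hb ⊢
      omega
  · rintro ⟨p, a, p', a'⟩ hq
    simp only [Finset.coe_filter, Finset.mem_product, Set.mem_ofPred_eq] at hq
    simpa using ⟨hq.1.2.1, hq.1.2.2.2⟩

/-- A finite set of at most `C log X` integers in `[0, X]` that is well distributed modulo the
small primes has a bounded mean square of representations as a prime plus an element. -/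
theorem exists_card_rep_pairs_le {C δ : ℝ} (hC : 0 < C) (hδ : 0 < δ) :
    ∃ C' > (0 : ℝ), ∀ X : ℕ, 2 ≤ X → ∀ A : Finset ℕ, (∀ a ∈ A, a ≤ X) →
      (A.card : ℝ) ≤ C * Real.log X →
      (∀ p : ℕ, p.Prime → p ≠ 2 → p ≤ Nat.log 2 X →
        (((A ×ˢ A).filter (fun b : ℕ × ℕ => b.1 ≡ b.2 [MOD p])).card : ℝ) ≤
          C * Real.log X ^ 2 *
            (if orderOf (2 : ZMod p) ^ 3 < p then 1 else (p : ℝ) ^ (-δ))) →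
      ((((Finset.Icc 1 X).filter Nat.Prime ×ˢ A ×ˢ
        (Finset.Icc 1 X).filter Nat.Prime ×ˢ A).filter
          (fun q : ℕ × ℕ × ℕ × ℕ => q.1 + q.2.1 = q.2.2.1 + q.2.2.2)).card : ℝ) ≤ C' * X := by
  obtain ⟨η, hη, C₃, hC₃, h₃⟩ := exists_sum_orderOf_two_le hδ
  obtain ⟨C₂, hC₂, h₂⟩ := exists_exp_sum_inv_primeFactors_le hη
  obtain ⟨C₁, hC₁, h₁⟩ := exists_card_prime_pairs_le
  have hl4 : 0 < Real.log 4 := Real.log_pos (by norm_num)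
  refine ⟨C * (2 * Real.log 4 + 2) + C₁ * C₂ * (C ^ 2 + C * C₃), by positivity,
    fun X hX A hA hcard hmod => ?_⟩
  have hX' : (2 : ℝ) ≤ X := by exact_mod_cast hX
  have hlog : 0 < Real.log X := Real.log_pos (by linarith)
  set ℓ := Nat.log 2 X with hℓ
  set T := (Finset.Icc 1 ℓ).filter (fun p => p.Prime ∧ p ≠ 2) with hT
  set g : ℕ → ℝ := fun h =>
    (((Finset.Icc 1 X).filter (fun p => p.Prime ∧ (p + h).Prime)).card : ℝ) with hg
  set d : ℕ × ℕ → ℕ := fun b => (b.1 - b.2) + (b.2 - b.1) with hd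
  have hoff : ∀ b ∈ A.offDiag, g (d b) ≤ C₁ * C₂ * (X / Real.log X ^ 2) *
      (1 + ∑ p ∈ T, (p : ℝ) ^ (η - 1) * (if b.1 ≡ b.2 [MOD p] then 1 else 0)) := by
    rintro ⟨a, a'⟩ hb
    rw [Finset.mem_offDiag] at hb
    obtain ⟨ha, ha', hne⟩ := hb
    dsimp only at ha ha' hne
    have hd0 : d (a, a') ≠ 0 := by simp only [hd]; omega
    have hdX : d (a, a') ≤ X := by
      have := hA a ha
      have := hA a' ha'
      simp only [hd]; omega
    have e1 := h₁ X (d (a, a')) hX (Nat.pos_of_ne_zero hd0)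
    have e2 := h₂ (d (a, a')) ℓ
      ((card_primeFactors_le_log hd0).trans (Nat.log_mono_right hdX))
    have e3 : ∑ p ∈ (d (a, a')).primeFactors.filter (fun p => p ≠ 2 ∧ p ≤ ℓ), (p : ℝ) ^ (η - 1)
        ≤ ∑ p ∈ T, (p : ℝ) ^ (η - 1) * (if a ≡ a' [MOD p] then 1 else 0) := by
      simp only [mul_ite, mul_one, mul_zero]
      rw [← Finset.sum_filter]
      refine Finset.sum_le_sum_of_subset_of_nonneg (fun p hp => ?_) (fun _ _ _ => by positivity)
      simp only [hT, Finset.mem_filter, Nat.mem_primeFactors, Finset.mem_Icc] at hp ⊢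
      refine ⟨⟨⟨hp.1.1.one_le, hp.2.2⟩, hp.1.1, hp.2.1⟩, ?_⟩
      have hdvd := hp.1.2.1
      simp only [hd] at hdvd
      rcases le_total a a' with h | h
      · rw [Nat.sub_eq_zero_of_le h, zero_add] at hdvd
        exact (Nat.modEq_iff_dvd' h).mpr hdvd
      · rw [Nat.sub_eq_zero_of_le h, add_zero] at hdvd
        exact ((Nat.modEq_iff_dvd' h).mpr hdvd).symm
    calc g (d (a, a')) ≤ C₁ * (X / Real.log X ^ 2) * (C₂ * (1 + _)) :=
          e1.trans (mul_le_mul_of_nonneg_left e2 (by positivity))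
      _ ≤ C₁ * (X / Real.log X ^ 2) *
          (C₂ * (1 + ∑ p ∈ T, (p : ℝ) ^ (η - 1) * (if a ≡ a' [MOD p] then 1 else 0))) := by
          gcongr
      _ = _ := by ring
  have hsum : ∑ b ∈ A.offDiag,
      (1 + ∑ p ∈ T, (p : ℝ) ^ (η - 1) * (if b.1 ≡ b.2 [MOD p] then 1 else 0)) ≤
      (C ^ 2 + C * C₃) * Real.log X ^ 2 := by
    calc _ ≤ ∑ b ∈ A ×ˢ A,
          (1 + ∑ p ∈ T, (p : ℝ) ^ (η - 1) * (if b.1 ≡ b.2 [MOD p] then 1 else 0)) :=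
          Finset.sum_le_sum_of_subset_of_nonneg
            (fun b hb => by
              rw [Finset.mem_offDiag] at hb
              exact Finset.mem_product.mpr ⟨hb.1, hb.2.1⟩)
            (fun _ _ _ => by positivity)
      _ = (A.card : ℝ) ^ 2 + ∑ p ∈ T, (p : ℝ) ^ (η - 1) *
          (((A ×ˢ A).filter (fun b : ℕ × ℕ => b.1 ≡ b.2 [MOD p])).card : ℝ) := by
          rw [Finset.sum_add_distrib, Finset.sum_comm]
          congr 1
          · simp [Finset.card_product]; ring
          · refine Finset.sum_congr rfl fun p _ => ?_
            rw [← Finset.mul_sum, Finset.sum_boole]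
      _ ≤ (C * Real.log X) ^ 2 + ∑ p ∈ T, (p : ℝ) ^ (η - 1) * (C * Real.log X ^ 2 *
            (if orderOf (2 : ZMod p) ^ 3 < p then 1 else (p : ℝ) ^ (-δ))) := by
          gcongr with p hp
          simp only [hT, Finset.mem_filter, Finset.mem_Icc] at hp
          exact hmod p hp.2.1 hp.2.2 hp.1.2
      _ = (C * Real.log X) ^ 2 + C * Real.log X ^ 2 * ∑ p ∈ T, (p : ℝ) ^ (η - 1) *
            (if orderOf (2 : ZMod p) ^ 3 < p then 1 else (p : ℝ) ^ (-δ)) := by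
          rw [Finset.mul_sum]
          congr 1
          exact Finset.sum_congr rfl fun p _ => by ring
      _ ≤ (C * Real.log X) ^ 2 + C * Real.log X ^ 2 * C₃ := by
          gcongr
          exact h₃ T fun p hp => (Finset.mem_filter.mp hp).2
      _ = _ := by ring
  have hdiag : ∑ b ∈ A.diag, g (d b) ≤ C * (2 * Real.log 4 + 2) * X := by
    calc ∑ b ∈ A.diag, g (d b)
        = ∑ b ∈ A.diag, (((Finset.Icc 1 X).filter Nat.Prime).card : ℝ) := by
          refine Finset.sum_congr rfl fun b hb => ?_
          rw [Finset.mem_diag] at hb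
          simp [hg, hd, hb.2]
      _ = A.card * (((Finset.Icc 1 X).filter Nat.Prime).card : ℝ) := by
          rw [Finset.sum_const, Finset.diag_card, nsmul_eq_mul]
      _ ≤ C * Real.log X * ((2 * Real.log 4 + 2) * (X / Real.log X)) :=
          mul_le_mul hcard (card_primes_Icc_le hX) (by positivity) (by positivity)
      _ = _ := by field_simp
  calc _ ≤ ∑ b ∈ A ×ˢ A, g (d b) := by
        simp only [hg, hd]
        exact_mod_cast card_rep_pairs_le X A
    _ = ∑ b ∈ A.diag, g (d b) + ∑ b ∈ A.offDiag, g (d b) := by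
        rw [← Finset.diag_union_offDiag, Finset.sum_union (Finset.disjoint_diag_offDiag A)]
    _ ≤ C * (2 * Real.log 4 + 2) * X + C₁ * C₂ * (X / Real.log X ^ 2) *
        ((C ^ 2 + C * C₃) * Real.log X ^ 2) := by
        refine add_le_add hdiag ((Finset.sum_le_sum hoff).trans ?_)
        rw [← Finset.mul_sum]
        exact mul_le_mul_of_nonneg_left hsum (by positivity)
    _ = _ := by field_simp

/-- In a box, a function of the shape `2 ^ u (k i₀) + G k` with `G` independent of the coordinate
`i₀` hits each residue class modulo `p` about as rarely as `u` hits the classes modulo the order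
of `2`. -/
lemma card_piFinset_modEq_mul_le {ι : Type*} [Fintype ι] [DecidableEq ι] (K : ι → ℕ) (i₀ : ι)
    {p : ℕ} (hp : p.Prime) (hp2 : p ≠ 2) {F G : (ι → ℕ) → ℕ} {u : ℕ → ℕ}
    (hF : ∀ k, F k = 2 ^ u (k i₀) + G k) (hG : ∀ k x, G (Function.update k i₀ x) = G k)
    {D : ℕ} (hD : ∀ c, ((Finset.Icc 1 (K i₀)).filter
      (fun x => u x ≡ c [MOD orderOf (2 : ZMod p)])).card ≤ D) (c : ℕ) :
    ((Fintype.piFinset fun i => Finset.Icc 1 (K i)).filter (fun k => F k ≡ c [MOD p])).card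
      * K i₀ ≤ D * (Fintype.piFinset fun i => Finset.Icc 1 (K i)).card := by
  classical
  set B := Fintype.piFinset fun i => Finset.Icc 1 (K i) with hB
  set S := B.filter (fun k => F k ≡ c [MOD p]) with hS
  set φ : (ι → ℕ) → (ι → ℕ) := fun k => Function.update k i₀ 1 with hφ
  have hfin : IsOfFinOrder (2 : ZMod p) := orderOf_pos_iff.mp (orderOf_two_pos hp hp2)
  have hrec : ∀ k k', φ k = φ k' → k i₀ = k' i₀ → k = k' := by
    intro k k' h h'
    funext i
    by_cases hi : i = i₀
    · rw [hi, h']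
    · simpa [hφ, hi] using congrFun h i
  have h1 : S.card ≤ D * (S.image φ).card := by
    refine Finset.card_le_mul_card_image S D fun b hb => ?_
    obtain ⟨k₁, hk₁, rfl⟩ := Finset.mem_image.mp hb
    refine le_trans ?_ (hD (u (k₁ i₀)))
    refine Finset.card_le_card_of_injOn (fun k => k i₀) (fun k hk => ?_) (fun k hk k' hk' h => ?_)
    · simp only [hS, Finset.coe_filter, Finset.mem_filter, Set.mem_ofPred_eq] at hk hk₁ ⊢
      obtain ⟨⟨hkB, hk⟩, hkφ⟩ := hk
      refine ⟨Fintype.mem_piFinset.mp hkB i₀, ?_⟩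
      have hGk : G k = G k₁ := by
        rw [← hG k 1, ← hG k₁ 1]
        exact congrArg G hkφ
      have h2 : F k ≡ F k₁ [MOD p] := hk.trans hk₁.2.symm
      rw [hF, hF, hGk] at h2
      have h3 := (ZMod.natCast_eq_natCast_iff _ _ _).mpr (Nat.ModEq.add_right_cancel' _ h2)
      push_cast at h3
      exact hfin.pow_eq_pow_iff_modEq.mp h3
    · simp only [Finset.coe_filter, Set.mem_ofPred_eq] at hk hk'
      exact hrec k k' (hk.2.trans hk'.2.symm) h
  have h2 : (S.image φ).card * K i₀ ≤ B.card := by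
    calc (S.image φ).card * K i₀ = (S.image φ ×ˢ Finset.Icc 1 (K i₀)).card := by
          rw [Finset.card_product, Nat.card_Icc, Nat.add_sub_cancel]
      _ ≤ B.card := by
          refine Finset.card_le_card_of_injOn (fun b => Function.update b.1 i₀ b.2) ?_ ?_
          · rintro ⟨b, x⟩ hb
            simp only [Finset.coe_product, Set.mem_prod, Finset.mem_coe, Finset.mem_image] at hb
            obtain ⟨⟨k, hk, rfl⟩, hx⟩ := hb
            have hkB := Fintype.mem_piFinset.mp (Finset.mem_filter.mp hk).1
            refine Finset.mem_coe.mpr (Fintype.mem_piFinset.mpr fun i => ?_)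
            by_cases hi : i = i₀
            · subst hi
              simpa using hx
            · simpa [hφ, hi] using hkB i
          · rintro ⟨b, x⟩ hb ⟨b', x'⟩ hb' h
            simp only [Finset.coe_product, Set.mem_prod, Finset.mem_coe, Finset.mem_image] at hb hb'
            obtain ⟨⟨k, -, rfl⟩, -⟩ := hb
            obtain ⟨⟨k', -, rfl⟩, -⟩ := hb'
            simp only [hφ, Function.update_idem] at h
            have hx : x = x' := by simpa using congrFun h i₀
            have hk : φ k = φ k' := by
              have := congrArg (fun f => Function.update f i₀ 1) h
              simpa [hφ] using this
            exact Prod.ext hk hx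
  calc S.card * K i₀ ≤ D * (S.image φ).card * K i₀ := Nat.mul_le_mul_right _ h1
    _ = D * ((S.image φ).card * K i₀) := by ring
    _ ≤ D * B.card := Nat.mul_le_mul_left _ h2

/-- The sizes of a box containing all the parameters of the elements of `romA` that are smaller
than `2 ^ L`. -/
noncomputable def romBox (s : ℕ) (r : Fin s → ℝ) (lam : ℝ) (L : ℕ) (i : Fin s) : ℕ :=
  ⌊if (i : ℕ) < s - 1 then (L : ℝ) ^ (r i)⁻¹ else 2 * (L : ℝ) ^ (lam * r i)⁻¹⌋₊

lemma card_romBox_le {s : ℕ} (hs : 0 < s) {r : Fin s → ℝ} {lam : ℝ}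
    (hsum : (∑ i ∈ Finset.univ.filter (fun i : Fin s => (i : ℕ) < s - 1), (r i)⁻¹)
      + (lam * r ⟨s - 1, by omega⟩)⁻¹ = 1) {L : ℕ} (hL : 0 < L) :
    ((Fintype.piFinset fun i => Finset.Icc 1 (romBox s r lam L i)).card : ℝ) ≤ 2 * L := by
  have hL' : (0 : ℝ) < L := by exact_mod_cast hL
  have hlast : Finset.univ.filter (fun i : Fin s => ¬ (i : ℕ) < s - 1) =
      {(⟨s - 1, by omega⟩ : Fin s)} := by
    ext i
    simp only [Finset.mem_filter, Finset.mem_univ, true_and, Finset.mem_singleton, Fin.ext_iff]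
    omega
  rw [Fintype.card_piFinset]
  push_cast [Nat.card_Icc, Nat.add_sub_cancel]
  calc ∏ i, (romBox s r lam L i : ℝ)
      ≤ ∏ i : Fin s, (if (i : ℕ) < s - 1 then (L : ℝ) ^ (r i)⁻¹
          else 2 * (L : ℝ) ^ (lam * r i)⁻¹) := by
        refine Finset.prod_le_prod (fun _ _ => by positivity) fun i _ => Nat.floor_le ?_
        split_ifs <;> positivity
    _ = 2 * L := by
        rw [Finset.prod_ite, hlast, Finset.prod_singleton, ← Real.rpow_sum_of_pos hL',
          mul_left_comm, ← Real.rpow_add hL', hsum, Real.rpow_one]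

/-- The element of `romA` with parameters `k`. -/
noncomputable def romVal (s : ℕ) (hs : 0 < s) (r : Fin s → ℝ) (lam : ℝ) (k : Fin s → ℕ) : ℕ :=
  (∑ i ∈ Finset.univ.filter (fun i : Fin s => (i : ℕ) < s - 1), 2 ^ ⌊(k i : ℝ) ^ (r i)⌋₊)
    + 2 ^ ⌊((⌊(k ⟨s - 1, by omega⟩ : ℝ) ^ lam⌋₊ : ℕ) : ℝ) ^ (r ⟨s - 1, by omega⟩)⌋₊

lemma le_rpow_inv_of_two_pow_floor_le {m X : ℕ} {ρ : ℝ} (hρ : 0 < ρ)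
    (h : 2 ^ ⌊(m : ℝ) ^ ρ⌋₊ ≤ X) : (m : ℝ) ≤ ((Nat.log 2 X + 1 : ℕ) : ℝ) ^ ρ⁻¹ := by
  have h1 : ⌊(m : ℝ) ^ ρ⌋₊ ≤ Nat.log 2 X := Nat.le_log_of_pow_le (by norm_num) h
  have h2 : (m : ℝ) ^ ρ < ((Nat.log 2 X + 1 : ℕ) : ℝ) := by
    have h3 := Nat.lt_floor_add_one ((m : ℝ) ^ ρ)
    have h4 : (⌊(m : ℝ) ^ ρ⌋₊ : ℝ) ≤ (Nat.log 2 X : ℝ) := by exact_mod_cast h1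
    push_cast
    linarith
  exact (Real.le_rpow_inv_iff_of_pos (by positivity) (by positivity) hρ).mpr h2.le

lemma mem_romBox_of_romVal_le {s : ℕ} (hs : 0 < s) {r : Fin s → ℝ} (hr : ∀ i, 1 < r i) {lam : ℝ}
    (hlam : 1 ≤ lam) {X : ℕ} {k : Fin s → ℕ} (hk : ∀ i, 0 < k i)
    (h : romVal s hs r lam k ≤ X) :
    k ∈ Fintype.piFinset fun i => Finset.Icc 1 (romBox s r lam (Nat.log 2 X + 1) i) := by
  refine Fintype.mem_piFinset.mpr fun i => Finset.mem_Icc.mpr ⟨hk i, Nat.le_floor ?_⟩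
  have hri : 0 < r i := by linarith [hr i]
  unfold romVal at h
  split_ifs with hi
  · refine le_rpow_inv_of_two_pow_floor_le hri (le_trans ?_ h)
    refine le_trans ?_ (Nat.le_add_right _ _)
    exact Finset.single_le_sum (f := fun i => 2 ^ ⌊(k i : ℝ) ^ (r i)⌋₊) (fun _ _ => Nat.zero_le _)
      (Finset.mem_filter.mpr ⟨Finset.mem_univ i, hi⟩)
  · have hi' : (⟨s - 1, by omega⟩ : Fin s) = i := by
      rw [Fin.ext_iff]
      simp only
      omega
    rw [hi'] at h
    have h1 := le_rpow_inv_of_two_pow_floor_le hri ((Nat.le_add_left _ _).trans h)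
    set L : ℕ := Nat.log 2 X + 1 with hL
    have hL1 : (1 : ℝ) ≤ L := by exact_mod_cast Nat.le_add_left 1 _
    have h2 : (1 : ℝ) ≤ (L : ℝ) ^ (r i)⁻¹ := Real.one_le_rpow hL1 (by positivity)
    have h3 : (k i : ℝ) ^ lam ≤ 2 * (L : ℝ) ^ (r i)⁻¹ := by
      linarith [Nat.lt_floor_add_one ((k i : ℝ) ^ lam)]
    have hlam0 : 0 < lam := by linarith
    calc (k i : ℝ) ≤ (2 * (L : ℝ) ^ (r i)⁻¹) ^ lam⁻¹ :=
          (Real.le_rpow_inv_iff_of_pos (by positivity) (by positivity) hlam0).mpr h3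
      _ = 2 ^ lam⁻¹ * (L : ℝ) ^ (lam * r i)⁻¹ := by
          rw [Real.mul_rpow (by norm_num) (by positivity), ← Real.rpow_mul (by positivity),
            mul_inv, mul_comm (r i)⁻¹]
      _ ≤ 2 * (L : ℝ) ^ (lam * r i)⁻¹ := by
          gcongr
          calc (2 : ℝ) ^ lam⁻¹ ≤ 2 ^ (1 : ℝ) :=
                Real.rpow_le_rpow_of_exponent_le (by norm_num) (inv_le_one_of_one_le₀ hlam)
            _ = 2 := Real.rpow_one 2

/-- The elements of `romA` up to `X` lie in a set of size `O(log X)` which is well distributed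
modulo the primes `p` for which `2` has not too small order. -/
lemma exists_romA_cover (s : ℕ) (hs : 1 < s) (r : Fin s → ℝ) (hr : ∀ i, 1 < r i)
    (hri : ∀ i, ∀ m : ℤ, r i ≠ m) (lam : ℝ) (hlam : 1 ≤ lam)
    (hsum : (∑ i ∈ Finset.univ.filter (fun i : Fin s => (i : ℕ) < s - 1), (r i)⁻¹)
      + (lam * r ⟨s - 1, by omega⟩)⁻¹ = 1) :
    ∃ C > (0 : ℝ), ∃ δ > (0 : ℝ), ∀ X : ℕ, 2 ≤ X → ∃ A : Finset ℕ, (∀ a ∈ A, a ≤ X) ∧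
      (∀ a ∈ romA s (by omega) r lam, a ≤ X → a ∈ A) ∧ (A.card : ℝ) ≤ C * Real.log X ∧
      ∀ p : ℕ, p.Prime → p ≠ 2 → p ≤ Nat.log 2 X →
        (((A ×ˢ A).filter (fun b : ℕ × ℕ => b.1 ≡ b.2 [MOD p])).card : ℝ) ≤
          C * Real.log X ^ 2 *
            (if orderOf (2 : ZMod p) ^ 3 < p then 1 else (p : ℝ) ^ (-δ)) := by
  have hs0 : 0 < s := by omega
  set i₀ : Fin s := ⟨0, hs0⟩ with hi₀
  have hi₀s : (i₀ : ℕ) < s - 1 := by simp only [hi₀]; omega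
  have hr₀ : 0 < r i₀ := by linarith [hr i₀]
  obtain ⟨C₀, hC₀, δ₀, hδ₀, h₀⟩ := exists_card_floor_rpow_modEq_le (hr i₀) (hri i₀)
  set κ : ℝ := min (1 / 3) (r i₀)⁻¹ with hκ
  have hκ0 : 0 < κ := lt_min (by norm_num) (by positivity)
  refine ⟨36 * (1 + C₀ * 2 ^ δ₀), by positivity, κ * δ₀, by positivity, fun X hX => ?_⟩
  have hX' : (2 : ℝ) ≤ X := by exact_mod_cast hX
  have hlog : 0 < Real.log X := Real.log_pos (by linarith)
  set L : ℕ := Nat.log 2 X + 1 with hL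
  set K := romBox s r lam L with hK
  set B := Fintype.piFinset fun i => Finset.Icc 1 (K i) with hB
  set F := romVal s hs0 r lam with hF
  have hL1 : (1 : ℝ) ≤ L := by exact_mod_cast Nat.le_add_left 1 _
  have hLX : (L : ℝ) ≤ 3 * Real.log X := by
    have h1 : Real.log 2 ≤ Real.log X := Real.log_le_log (by norm_num) hX'
    have h2 : (2 : ℝ) ^ Nat.log 2 X ≤ X := by
      exact_mod_cast Nat.pow_log_le_self 2 (by omega : X ≠ 0)
    have h3 := Real.log_le_log (by positivity) h2
    rw [Real.log_pow] at h3
    have h4 := Real.log_two_gt_d9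
    have h5 : (L : ℝ) = (Nat.log 2 X : ℝ) + 1 := by rw [hL]; push_cast; ring
    have h6 : (L : ℝ) * Real.log 2 ≤ 2 * Real.log X := by rw [h5]; linarith
    nlinarith
  have hBcard : (B.card : ℝ) ≤ 6 * Real.log X := by
    have := card_romBox_le hs0 hsum (L := L) (by omega)
    linarith
  refine ⟨(B.image F).filter (· ≤ X), fun a ha => (Finset.mem_filter.mp ha).2, ?_, ?_, ?_⟩
  · rintro a ⟨k, hk, rfl⟩ haX
    exact Finset.mem_filter.mpr
      ⟨Finset.mem_image_of_mem F (mem_romBox_of_romVal_le hs0 hr hlam hk haX), haX⟩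
  · calc ((((B.image F).filter (· ≤ X)).card : ℕ) : ℝ) ≤ B.card := by
          exact_mod_cast (Finset.card_filter_le _ _).trans Finset.card_image_le
      _ ≤ 6 * Real.log X := hBcard
      _ ≤ _ := by
          gcongr
          have : 0 < C₀ * 2 ^ δ₀ := by positivity
          linarith
  · intro p hp hp2 hpX
    have hpairs : (((((B.image F).filter (· ≤ X)) ×ˢ ((B.image F).filter (· ≤ X))).filter
        (fun b : ℕ × ℕ => b.1 ≡ b.2 [MOD p])).card) ≤
        ((B ×ˢ B).filter (fun b => F b.1 ≡ F b.2 [MOD p])).card := by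
      refine Finset.card_le_card_of_surjOn (fun b => (F b.1, F b.2)) ?_
      rintro ⟨a, a'⟩ h
      simp only [Finset.coe_filter, Finset.mem_product, Finset.mem_filter, Finset.mem_image,
        Set.mem_ofPred_eq] at h
      obtain ⟨⟨⟨⟨k, hk, rfl⟩, -⟩, ⟨⟨k', hk', rfl⟩, -⟩⟩, hm⟩ := h
      refine ⟨(k, k'), ?_, rfl⟩
      simp only [Finset.coe_filter, Finset.mem_product, Set.mem_ofPred_eq]
      exact ⟨⟨hk, hk'⟩, hm⟩
    refine le_trans (Nat.cast_le.mpr hpairs) ?_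
    have hBsq : (B.card : ℝ) ^ 2 ≤ 36 * Real.log X ^ 2 := by
      calc (B.card : ℝ) ^ 2 ≤ (6 * Real.log X) ^ 2 := by gcongr
        _ = _ := by ring
    have hCpos : 0 < C₀ * 2 ^ δ₀ := by positivity
    split_ifs with hbad
    · calc (((B ×ˢ B).filter (fun b => F b.1 ≡ F b.2 [MOD p])).card : ℝ)
          ≤ (B.card : ℝ) ^ 2 := by
            rw [sq]
            exact_mod_cast (Finset.card_filter_le _ _).trans (Finset.card_product _ _).le
        _ ≤ 36 * Real.log X ^ 2 := hBsq
        _ ≤ _ := by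
            rw [mul_one]
            gcongr
            linarith
    · set e := orderOf (2 : ZMod p) with he
      have hp1 : (1 : ℝ) ≤ p := by exact_mod_cast hp.one_le
      have hpL : (p : ℝ) ≤ L := by exact_mod_cast hpX.trans (Nat.le_succ _)
      set M : ℝ := (p : ℝ) ^ κ / 2 with hM
      have hM0 : 0 < M := by positivity
      have hKM : M ≤ K i₀ := by
        have h1 : (p : ℝ) ^ κ ≤ (L : ℝ) ^ (r i₀)⁻¹ :=
          (Real.rpow_le_rpow_of_exponent_le hp1 (min_le_right _ _)).trans
            (Real.rpow_le_rpow (by positivity) hpL (by positivity))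
        have h2 : (1 : ℝ) ≤ (L : ℝ) ^ (r i₀)⁻¹ := Real.one_le_rpow hL1 (by positivity)
        have h3 : K i₀ = ⌊(L : ℝ) ^ (r i₀)⁻¹⌋₊ := by
          simp only [hK, romBox, if_pos hi₀s]
        have h4 : 1 ≤ K i₀ := by
          rw [h3]
          exact Nat.le_floor (by simpa using h2)
        have h5 : (L : ℝ) ^ (r i₀)⁻¹ < K i₀ + 1 := by
          rw [h3]
          exact Nat.lt_floor_add_one _
        have h6 : (1 : ℝ) ≤ K i₀ := by exact_mod_cast h4
        rw [hM]
        linarith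
      have heM : M ≤ e := by
        have h1 : (p : ℝ) ≤ (e : ℝ) ^ 3 := by exact_mod_cast not_lt.mp hbad
        have h2 : (p : ℝ) ^ κ ≤ e := by
          calc (p : ℝ) ^ κ ≤ (p : ℝ) ^ (1 / 3 : ℝ) :=
                Real.rpow_le_rpow_of_exponent_le hp1 (min_le_left _ _)
            _ ≤ ((e : ℝ) ^ 3) ^ (1 / 3 : ℝ) := Real.rpow_le_rpow (by positivity) h1 (by norm_num)
            _ = e := by
                rw [← Real.rpow_natCast, ← Real.rpow_mul (by positivity)]
                norm_num
        have h3 : 0 < (p : ℝ) ^ κ := by positivity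
        rw [hM]
        linarith
      have hK0 : (0 : ℝ) < K i₀ := hM0.trans_le hKM
      set D : ℝ := C₀ * K i₀ * M ^ (-δ₀) with hD
      have hD0 : 0 ≤ D := by positivity
      have hcoord : ∀ c, ((B.filter (fun k => F k ≡ c [MOD p])).card : ℝ) ≤
          C₀ * M ^ (-δ₀) * B.card := by
        intro c
        have h1 := card_piFinset_modEq_mul_le K i₀ hp hp2 (F := F)
          (G := fun k => (∑ i ∈ (Finset.univ.filter
            (fun i : Fin s => (i : ℕ) < s - 1)).erase i₀, 2 ^ ⌊(k i : ℝ) ^ (r i)⌋₊)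
            + 2 ^ ⌊((⌊(k ⟨s - 1, by omega⟩ : ℝ) ^ lam⌋₊ : ℕ) : ℝ) ^ (r ⟨s - 1, by omega⟩)⌋₊)
          (u := fun x => ⌊(x : ℝ) ^ (r i₀)⌋₊) (fun k => by
            simp only [hF, romVal]
            rw [← Finset.add_sum_erase (Finset.univ.filter
              (fun i : Fin s => (i : ℕ) < s - 1)) _
              (Finset.mem_filter.mpr ⟨Finset.mem_univ i₀, hi₀s⟩), add_assoc]) (fun k x => by
            have hne : (⟨s - 1, by omega⟩ : Fin s) ≠ i₀ := by
              simp only [hi₀, ne_eq, Fin.mk.injEq]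
              omega
            simp only [Function.update_of_ne hne]
            congr 1
            refine Finset.sum_congr rfl fun i hi => ?_
            rw [Function.update_of_ne (Finset.ne_of_mem_erase hi)])
          (D := ⌊D⌋₊) (fun c => Nat.le_floor (h₀ (K i₀) e M hM0 hKM heM c)) c
        have h2 : ((B.filter (fun k => F k ≡ c [MOD p])).card : ℝ) * K i₀ ≤ D * B.card := by
          calc _ ≤ (⌊D⌋₊ : ℝ) * B.card := by exact_mod_cast h1
            _ ≤ D * B.card := by
                gcongr
                exact Nat.floor_le hD0
        refine le_of_mul_le_mul_right (h2.trans (le_of_eq ?_)) hK0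
        rw [hD]
        ring
      have hMδ : M ^ (-δ₀) = 2 ^ δ₀ * (p : ℝ) ^ (-(κ * δ₀)) := by
        rw [hM, Real.div_rpow (by positivity) (by norm_num), ← Real.rpow_mul (by positivity),
          Real.rpow_neg (by norm_num : (0 : ℝ) ≤ 2), div_inv_eq_mul, mul_neg, mul_comm]
      calc (((B ×ˢ B).filter (fun b => F b.1 ≡ F b.2 [MOD p])).card : ℝ)
          = ∑ k' ∈ B, ((B.filter (fun k => F k ≡ F k' [MOD p])).card : ℝ) := by
            rw [← Finset.sum_boole, Finset.sum_product_right]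
            exact Finset.sum_congr rfl fun k' _ => Finset.sum_boole _ _
        _ ≤ ∑ k' ∈ B, C₀ * M ^ (-δ₀) * B.card := Finset.sum_le_sum fun k' _ => hcoord _
        _ = C₀ * 2 ^ δ₀ * (B.card : ℝ) ^ 2 * (p : ℝ) ^ (-(κ * δ₀)) := by
            rw [Finset.sum_const, nsmul_eq_mul, hMδ]
            ring
        _ ≤ C₀ * 2 ^ δ₀ * (36 * Real.log X ^ 2) * (p : ℝ) ^ (-(κ * δ₀)) := by gcongr
        _ = 36 * (C₀ * 2 ^ δ₀) * Real.log X ^ 2 * (p : ℝ) ^ (-(κ * δ₀)) := by ring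
        _ ≤ _ := by
            gcongr
            linarith

/-- `Σ_{n ≤ x} r(n)² ≪ x`, counted as the number of quadruples
`(p₁, a₁, p₂, a₂)` with `p₁, p₂` prime, `a₁, a₂ ∈ A` and `p₁ + a₁ = p₂ + a₂ ≤ x`. -/
theorem romA_rep_sq_sum_upper (s : ℕ) (hs : 2 ≤ s) (r : Fin s → ℝ) (hr : ∀ i, 1 < r i)
    (hri : ∀ i, ∀ m : ℤ, r i ≠ m) (lam : ℝ) (hlam : 1 ≤ lam)
    (hsum : (∑ i ∈ Finset.univ.filter (fun i : Fin s => (i : ℕ) < s - 1), (r i)⁻¹)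
      + (lam * r ⟨s - 1, by omega⟩)⁻¹ = 1) :
    ∃ C > (0 : ℝ), ∃ x₀ : ℝ, ∀ x : ℝ, x₀ ≤ x →
      (({q : ℕ × ℕ × ℕ × ℕ | q.1.Prime ∧ q.2.1 ∈ romA s (by omega) r lam ∧
        q.2.2.1.Prime ∧ q.2.2.2 ∈ romA s (by omega) r lam ∧
        q.1 + q.2.1 = q.2.2.1 + q.2.2.2 ∧
        ((q.1 + q.2.1 : ℕ) : ℝ) ≤ x} : Set (ℕ × ℕ × ℕ × ℕ)).ncard : ℝ) ≤ C * x := by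
  obtain ⟨C, hC, δ, hδ, hcover⟩ := exists_romA_cover s hs r hr hri lam hlam hsum
  obtain ⟨C', hC', hcount⟩ := exists_card_rep_pairs_le hC hδ
  refine ⟨C', hC', 2, fun x hx => ?_⟩
  have hx0 : 0 ≤ x := by linarith
  obtain ⟨A, hA, hmem, hcard, hmod⟩ := hcover ⌊x⌋₊ (Nat.le_floor (by simpa using hx))
  have hle := hcount ⌊x⌋₊ (Nat.le_floor (by simpa using hx)) A hA hcard hmod
  refine le_trans ?_ (hle.trans (mul_le_mul_of_nonneg_left (Nat.floor_le hx0) hC'.le))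
  rw [← Set.ncard_coe_finset]
  refine Nat.cast_le.mpr (Set.ncard_le_ncard ?_ (Finset.finite_toSet _))
  rintro ⟨p, a, p', a'⟩ ⟨hp, ha, hp', ha', heq, hpx⟩
  have hX : p + a ≤ ⌊x⌋₊ := Nat.le_floor hpx
  dsimp only at hp ha hp' ha' heq
  simp only [Finset.coe_filter, Finset.mem_product, Finset.mem_filter, Finset.mem_Icc,
    Set.mem_ofPred_eq]
  exact ⟨⟨⟨⟨hp.one_le, by omega⟩, hp⟩, hmem a ha (by omega), ⟨⟨hp'.one_le, by omega⟩, hp'⟩,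
    hmem a' ha' (by omega)⟩, heq⟩
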